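/- arXiv:2407.07140 — 11 statements merged into one kernel-verified Lean document; each statement's English description precedes it below -/
import Mathlib

section
/- Let n ≥ 2 and 1 ≤ k ≤ n. Let p be a probability vector on Fin n, v : Fin n → ℝ a score vector, σ a permutation of Fin n with p(σ 1) ≥ ⋯ ≥ p(σ n), and τ a permutation of Fin n with v(τ 1) ≥ ⋯ ≥ v(τ n). Define ψ(t) = ((1 − t)/2)·log(1 − t) + ((1 + t)/2)·log(1 + t) for t ∈ [0,1], with the convention 0·log 0 = 0. Then for every t ∈ [0,1] such that Δ_log(v) ≤ ψ(t), one has ∑_{i=1}^k (p(σ i) − p(τ i)) ≤ k·t. -/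
/-- The conditional logistic loss as log-partition function minus expected score. -/
theorem sum_mul_log_sum_exp_sub {n : ℕ} (hn : 0 < n) (p : Fin n → ℝ) (hpsum : ∑ y, p y = 1)
    (w : Fin n → ℝ) :
    ∑ y, p y * Real.log (∑ y', Real.exp (w y' - w y))
      = Real.log (∑ y, Real.exp (w y)) - ∑ y, p y * w y := by
  have : Nonempty (Fin n) := ⟨⟨0, hn⟩⟩
  have hZ : 0 < ∑ y, Real.exp (w y) :=
    Finset.sum_pos (fun y _ => Real.exp_pos _) Finset.univ_nonempty
  have h (y : Fin n) : Real.log (∑ y', Real.exp (w y' - w y))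
      = Real.log (∑ y', Real.exp (w y')) - w y := by
    simp_rw [Real.exp_sub]
    rw [← Finset.sum_div, Real.log_div hZ.ne' (Real.exp_ne_zero _), Real.log_exp]
  simp_rw [h, mul_sub, Finset.sum_sub_distrib, ← Finset.sum_mul, hpsum, one_mul]

theorem bddBelow_logistic_loss {n : ℕ} (p : Fin n → ℝ) (hp : ∀ y, 0 ≤ p y) :
    BddBelow (Set.range fun w : Fin n → ℝ =>
      ∑ y, p y * Real.log (∑ y', Real.exp (w y' - w y))) := by
  refine ⟨0, ?_⟩
  rintro _ ⟨w, rfl⟩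
  refine Finset.sum_nonneg fun y _ => mul_nonneg (hp y) (Real.log_nonneg ?_)
  have h := Finset.single_le_sum (f := fun y' => Real.exp (w y' - w y))
    (fun y' _ => (Real.exp_pos _).le) (Finset.mem_univ y)
  simpa using h

/-- Convexity bound for the exponential on `[-θ, θ]`, restricted to the points `-θ`, `0`, `θ`. -/
theorem exp_mul_le_cosh_add_mul_sinh {g : ℝ} (hg : g = -1 ∨ g = 0 ∨ g = 1) (θ : ℝ) :
    Real.exp (θ * g) ≤ Real.cosh θ + g * Real.sinh θ := by
  rcases hg with rfl | rfl | rfl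
  · rw [mul_neg_one, ← Real.cosh_sub_sinh]
    linarith
  · simp
  · rw [mul_one, ← Real.cosh_add_sinh]
    linarith

/-- Variational lower bound for the logistic regret in a direction `g` that is
nonpositively correlated with the softmax weights. -/
theorem mul_sub_log_cosh_le_logistic_regret {n : ℕ} (hn : 0 < n) (p : Fin n → ℝ)
    (hp : ∀ y, 0 ≤ p y) (hpsum : ∑ y, p y = 1) (v g : Fin n → ℝ)
    (hg : ∀ y, g y = -1 ∨ g y = 0 ∨ g y = 1) (hgv : ∑ y, Real.exp (v y) * g y ≤ 0)
    {θ : ℝ} (hθ : 0 ≤ θ) :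
    θ * ∑ y, p y * g y - Real.log (Real.cosh θ)
      ≤ (∑ y, p y * Real.log (∑ y', Real.exp (v y' - v y)))
          - (⨅ w : Fin n → ℝ, ∑ y, p y * Real.log (∑ y', Real.exp (w y' - w y))) := by
  have : Nonempty (Fin n) := ⟨⟨0, hn⟩⟩
  have hinf := ciInf_le (bddBelow_logistic_loss p hp) (fun y => v y + θ * g y)
  rw [sum_mul_log_sum_exp_sub hn p hpsum (fun y => v y + θ * g y)] at hinf
  rw [sum_mul_log_sum_exp_sub hn p hpsum v]
  have hZ : 0 < ∑ y, Real.exp (v y) :=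
    Finset.sum_pos (fun y _ => Real.exp_pos _) Finset.univ_nonempty
  have hZ' : 0 < ∑ y, Real.exp (v y + θ * g y) :=
    Finset.sum_pos (fun y _ => Real.exp_pos _) Finset.univ_nonempty
  have hle : ∑ y, Real.exp (v y + θ * g y) ≤ (∑ y, Real.exp (v y)) * Real.cosh θ := by
    calc ∑ y, Real.exp (v y + θ * g y)
        ≤ ∑ y, Real.exp (v y) * (Real.cosh θ + g y * Real.sinh θ) := by
          refine Finset.sum_le_sum fun y _ => ?_
          rw [Real.exp_add]
          exact mul_le_mul_of_nonneg_left (exp_mul_le_cosh_add_mul_sinh (hg y) θ)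
            (Real.exp_pos _).le
      _ = (∑ y, Real.exp (v y)) * Real.cosh θ
            + (∑ y, Real.exp (v y) * g y) * Real.sinh θ := by
          rw [Finset.sum_mul, Finset.sum_mul, ← Finset.sum_add_distrib]
          exact Finset.sum_congr rfl fun y _ => by ring
      _ ≤ (∑ y, Real.exp (v y)) * Real.cosh θ := by
          linarith [mul_nonpos_of_nonpos_of_nonneg hgv (Real.sinh_nonneg_iff.2 hθ)]
  have hlog := Real.log_le_log hZ' hle
  rw [Real.log_mul hZ.ne' (Real.cosh_pos θ).ne'] at hlog
  have hlin : ∑ y, p y * (v y + θ * g y) = ∑ y, p y * v y + θ * ∑ y, p y * g y := by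
    rw [Finset.mul_sum, ← Finset.sum_add_distrib]
    exact Finset.sum_congr rfl fun y _ => by ring
  linarith

/-- A finset containing only values above a threshold, and all values strictly above it,
has the largest sum among finsets of its cardinality. -/
theorem sum_le_sum_of_card_eq_of_threshold {ι : Type*} [Fintype ι] [DecidableEq ι]
    {A B : Finset ι} (hcard : A.card = B.card) (f : ι → ℝ) (c : ℝ)
    (hB : ∀ y ∈ B, c ≤ f y) (hBc : ∀ y ∉ B, f y ≤ c) :
    ∑ y ∈ A, f y ≤ ∑ y ∈ B, f y := by
  have h : ∑ y ∈ A, (f y - c) ≤ ∑ y ∈ B, (f y - c) := by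
    rw [← Finset.sum_filter_add_sum_filter_not A (· ∈ B)]
    have h₁ : ∑ y ∈ A with y ∉ B, (f y - c) ≤ 0 :=
      Finset.sum_nonpos fun y hy => sub_nonpos.2 (hBc y (Finset.mem_filter.1 hy).2)
    have h₂ : ∑ y ∈ A with y ∈ B, (f y - c) ≤ ∑ y ∈ B, (f y - c) :=
      Finset.sum_le_sum_of_subset_of_nonneg (fun y hy => (Finset.mem_filter.1 hy).2)
        fun y hy _ => sub_nonneg.2 (hB y hy)
    linarith
  simp only [Finset.sum_sub_distrib, Finset.sum_const, hcard] at h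
  linarith

/-- The binary convex conjugate relation: upper bounds for `θ * d - log (cosh θ)` yield
upper bounds for `d`. -/
theorem le_of_forall_mul_sub_log_cosh_le {d t : ℝ} (hd : d ≤ 1) (ht₀ : 0 ≤ t) (ht₁ : t ≤ 1)
    (h : ∀ θ : ℝ, 0 ≤ θ → θ * d - Real.log (Real.cosh θ)
      ≤ (1 - t) / 2 * Real.log (1 - t) + (1 + t) / 2 * Real.log (1 + t)) :
    d ≤ t := by
  rcases ht₁.eq_or_lt with rfl | ht₁
  · exact hd
  rcases ht₀.eq_or_lt with rfl | ht₀
  · by_contra! hpos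
    have hθ := h d hpos.le
    have hlog : Real.log (Real.cosh d) ≤ d ^ 2 / 2 := by
      rw [Real.log_le_iff_le_exp (Real.cosh_pos d)]
      exact Real.cosh_le_exp_half_sq d
    norm_num at hθ
    nlinarith
  · set a := Real.log (1 + t) with ha
    set b := Real.log (1 - t) with hb
    have hab : b < a := Real.log_lt_log (by linarith) (by linarith)
    have hea : Real.exp a = 1 + t := Real.exp_log (by linarith)
    have heb : Real.exp b = 1 - t := Real.exp_log (by linarith)
    have hcosh : Real.cosh ((a - b) / 2) = Real.exp (-(a + b) / 2) := by
      rw [Real.cosh_eq, show (a - b) / 2 = a + -(a + b) / 2 by ring,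
        show -(a + -(a + b) / 2) = b + -(a + b) / 2 by ring, Real.exp_add, Real.exp_add, hea, heb]
      ring
    have hθ := h ((a - b) / 2) (by linarith)
    rw [hcosh, Real.log_exp] at hθ
    have : (a - b) * d ≤ (a - b) * t := by linarith
    exact le_of_mul_le_mul_left this (sub_pos.2 hab)

/-- Pointwise form of the paper's Theorem 1 for the logistic loss: if the conditional
logistic regret of the score vector `v` is at most `ψ t`, then the top-`k` conditional
regret of `v` is at most `k * t`. -/
theorem topk_consistency_logistic
    (n k : ℕ) (hn : 2 ≤ n) (hk1 : 1 ≤ k) (hkn : k ≤ n)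
    (p : Fin n → ℝ) (hp : ∀ y, 0 ≤ p y) (hpsum : ∑ y, p y = 1)
    (v : Fin n → ℝ)
    (σ : Equiv.Perm (Fin n)) (hσ : ∀ i j : Fin n, i ≤ j → p (σ j) ≤ p (σ i))
    (τ : Equiv.Perm (Fin n)) (hτ : ∀ i j : Fin n, i ≤ j → v (τ j) ≤ v (τ i)) :
    ∀ t ∈ Set.Icc (0 : ℝ) 1,
      (∑ y, p y * Real.log (∑ y', Real.exp (v y' - v y)))
          - (⨅ w : Fin n → ℝ, ∑ y, p y * Real.log (∑ y', Real.exp (w y' - w y)))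
        ≤ (1 - t) / 2 * Real.log (1 - t) + (1 + t) / 2 * Real.log (1 + t) →
      ∑ i ∈ Finset.univ.filter (fun i : Fin n => (i : ℕ) < k), (p (σ i) - p (τ i))
        ≤ (k : ℝ) * t := by
  intro t ht hreg
  set I := Finset.univ.filter (fun i : Fin n => (i : ℕ) < k) with hI
  set A := I.map σ.toEmbedding with hA
  set B := I.map τ.toEmbedding with hB
  set g : Fin n → ℝ := fun y => (if y ∈ A then 1 else 0) - (if y ∈ B then 1 else 0) with hg
  have hg_sum (f : Fin n → ℝ) : ∑ y, f y * g y = ∑ y ∈ A, f y - ∑ y ∈ B, f y := by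
    simp [hg, mul_sub, Finset.sum_sub_distrib]
  have hg_cases (y : Fin n) : g y = -1 ∨ g y = 0 ∨ g y = 1 := by
    simp only [hg]
    split_ifs <;> norm_num
  have hd : ∑ i ∈ I, (p (σ i) - p (τ i)) = ∑ y, p y * g y := by
    rw [hg_sum, hA, hB, Finset.sum_map, Finset.sum_map, Finset.sum_sub_distrib]
    rfl
  have hgv : ∑ y, Real.exp (v y) * g y ≤ 0 := by
    rw [hg_sum, sub_nonpos]
    refine sum_le_sum_of_card_eq_of_threshold (by simp [hA, hB]) _
      (Real.exp (v (τ ⟨k - 1, by omega⟩))) (fun y hy => ?_) (fun y hy => ?_)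
    · obtain ⟨i, hi, rfl⟩ := Finset.mem_map.1 hy
      have hik : (i : ℕ) < k := (Finset.mem_filter.1 hi).2
      exact Real.exp_le_exp.2 (hτ _ _ (Fin.le_def.2 (by simp only; omega)))
    · obtain ⟨i, rfl⟩ := τ.surjective y
      have hik : ¬ (i : ℕ) < k := fun hik =>
        hy (Finset.mem_map.2 ⟨i, Finset.mem_filter.2 ⟨Finset.mem_univ i, hik⟩, rfl⟩)
      exact Real.exp_le_exp.2 (hτ _ _ (Fin.le_def.2 (by simp only; omega)))
  have hd_le : ∑ y, p y * g y ≤ 1 := by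
    rw [← hpsum]
    refine Finset.sum_le_sum fun y _ => mul_le_of_le_one_right (hp y) ?_
    rcases hg_cases y with h | h | h <;> rw [h] <;> norm_num
  have hdt : ∑ y, p y * g y ≤ t :=
    le_of_forall_mul_sub_log_cosh_le hd_le ht.1 ht.2 fun θ hθ =>
      (mul_sub_log_cosh_le_logistic_regret (by omega) p hp hpsum v g hg_cases hgv hθ).trans hreg
  rw [hd]
  exact hdt.trans (le_mul_of_one_le_left ht.1 (by exact_mod_cast hk1))
end

section
/- Let n ≥ 2 and 1 ≤ k ≤ n. Let p be a probability vector on Fin n, v : Fin n → ℝ a score vector, σ a permutation of Fin n with p(σ 1) ≥ ⋯ ≥ p(σ n), and τ a permutation of Fin n with v(τ 1) ≥ ⋯ ≥ v(τ n). Define ψ(t) = 1 − √(1 − t²) for t ∈ [0,1]. Then for every t ∈ [0,1] such that Δ_exp(v) ≤ ψ(t), one has ∑_{i=1}^k (p(σ i) − p(τ i)) ≤ k·t. -/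
/-- The conditional sum-exponential risk factors as a product of two sums, up to a constant. -/
lemma sum_exp_risk_eq {n : ℕ} {p : Fin n → ℝ} (hpsum : ∑ y, p y = 1) (w : Fin n → ℝ) :
    ∑ y, p y * ∑ y' ∈ Finset.univ.erase y, Real.exp (w y' - w y)
      = (∑ y, Real.exp (w y)) * (∑ y, p y / Real.exp (w y)) - 1 := by
  have h (y : Fin n) : p y * ∑ y' ∈ Finset.univ.erase y, Real.exp (w y' - w y)
      = (∑ y', Real.exp (w y')) * (p y / Real.exp (w y)) - p y := by
    rw [Finset.sum_erase_eq_sub (Finset.mem_univ y)]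
    simp only [Real.exp_sub, ← Finset.sum_div]
    have := (Real.exp_pos (w y)).ne'
    field_simp
  simp only [h, Finset.sum_sub_distrib, ← Finset.mul_sum, hpsum]

lemma iInf_sum_exp_risk_le {n : ℕ} {p : Fin n → ℝ} (hp : ∀ y, 0 ≤ p y) (hpsum : ∑ y, p y = 1) :
    (⨅ w : Fin n → ℝ, ∑ y, p y * ∑ y' ∈ Finset.univ.erase y, Real.exp (w y' - w y))
      ≤ (∑ y, √(p y)) ^ 2 - 1 := by
  have hbdd : BddBelow (Set.range fun w : Fin n → ℝ =>
      ∑ y, p y * ∑ y' ∈ Finset.univ.erase y, Real.exp (w y' - w y)) := by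
    refine ⟨0, ?_⟩
    rintro _ ⟨w, rfl⟩
    exact Finset.sum_nonneg fun y _ =>
      mul_nonneg (hp y) (Finset.sum_nonneg fun _ _ => (Real.exp_pos _).le)
  have hε (ε : ℝ) (h : 0 < ε) :
      (⨅ w : Fin n → ℝ, ∑ y, p y * ∑ y' ∈ Finset.univ.erase y, Real.exp (w y' - w y))
        ≤ (∑ y, (√(p y) + ε)) * (∑ y, √(p y)) - 1 := by
    refine (ciInf_le hbdd fun y => Real.log (√(p y) + ε)).trans ?_
    have hpos (y : Fin n) : 0 < √(p y) + ε := by positivity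
    rw [sum_exp_risk_eq hpsum]
    simp only [Real.exp_log (hpos _)]
    refine sub_le_sub_right (mul_le_mul_of_nonneg_left (Finset.sum_le_sum fun y _ => ?_)
      (Finset.sum_nonneg fun y _ => (hpos y).le)) 1
    rw [div_le_iff₀ (hpos y)]
    nlinarith [Real.sq_sqrt (hp y), mul_nonneg (Real.sqrt_nonneg (p y)) h.le]
  have hcont : Continuous fun ε : ℝ => (∑ y, (√(p y) + ε)) * (∑ y, √(p y)) - 1 := by fun_prop
  have hlim := (hcont.tendsto 0).mono_left (nhdsWithin_le_nhds (s := Set.Ioi 0))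
  have := ge_of_tendsto hlim (Filter.eventually_of_mem self_mem_nhdsWithin hε)
  simpa [sq] using this

/-- A strengthening of the Cauchy–Schwarz inequality when two weights are ordered against the
corresponding coefficients. -/
lemma sq_sum_sqrt_add_sq_le {ι : Type*} [Fintype ι] [DecidableEq ι] {p a : ι → ℝ}
    (hp : ∀ y, 0 ≤ p y) (ha : ∀ y, 0 < a y) {i j : ι} (hpij : p j < p i) (haij : a i ≤ a j) :
    (∑ y, √(p y)) ^ 2 + (√(p i) - √(p j)) ^ 2 ≤ (∑ y, a y) * (∑ y, p y / a y) := by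
  have hij : j ≠ i := by rintro rfl; exact hpij.false
  have hsplit (f : ι → ℝ) :
      ∑ y, f y = (f i + f j) + ∑ y ∈ (Finset.univ.erase i).erase j, f y := by
    rw [← Finset.add_sum_erase _ _ (Finset.mem_univ i), ← Finset.add_sum_erase _ _
      (Finset.mem_erase.2 ⟨hij, Finset.mem_univ j⟩), add_assoc]
  set s := (Finset.univ.erase i).erase j
  have hrest : (∑ y ∈ s, √(p y)) ^ 2 ≤ (∑ y ∈ s, a y) * ∑ y ∈ s, p y / a y := by
    refine Finset.sum_sq_le_sum_mul_sum_of_sq_le_mul s (fun y _ => (ha y).le)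
      (fun y _ => div_nonneg (hp y) (ha y).le) fun y _ => ?_
    rw [Real.sq_sqrt (hp y), mul_div_cancel₀ _ (ha y).ne']
  have hpair : (√(p i) + √(p j)) ^ 2 + (√(p i) - √(p j)) ^ 2
      ≤ (a i + a j) * (p i / a i + p j / a j) := by
    have hi := ha i
    have hj := ha j
    have key : (a i + a j) * (p i / a i + p j / a j) - 2 * (p i + p j)
        = (a j - a i) * (p i * a j - p j * a i) / (a i * a j) := by
      field_simp
      ring
    have hnn : 0 ≤ (a j - a i) * (p i * a j - p j * a i) / (a i * a j) :=
      div_nonneg (mul_nonneg (sub_nonneg.2 haij)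
        (sub_nonneg.2 (mul_le_mul hpij.le haij hi.le (hp i)))) (mul_pos hi hj).le
    nlinarith [Real.sq_sqrt (hp i), Real.sq_sqrt (hp j)]
  rw [hsplit, hsplit a, hsplit fun y => p y / a y]
  have hu : 0 ≤ √(p i) + √(p j) := by positivity
  have hu' : 0 ≤ ∑ y ∈ s, √(p y) := Finset.sum_nonneg fun _ _ => Real.sqrt_nonneg _
  have hX : 0 ≤ a i + a j := (add_pos (ha i) (ha j)).le
  have hX' : 0 ≤ ∑ y ∈ s, a y := Finset.sum_nonneg fun y _ => (ha y).le
  have hY : 0 ≤ p i / a i + p j / a j :=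
    add_nonneg (div_nonneg (hp i) (ha i).le) (div_nonneg (hp j) (ha j).le)
  have hY' : 0 ≤ ∑ y ∈ s, p y / a y := Finset.sum_nonneg fun y _ => div_nonneg (hp y) (ha y).le
  generalize √(p i) + √(p j) = u at *
  generalize (∑ y ∈ s, √(p y)) = u' at *
  generalize a i + a j = X at *
  generalize (∑ y ∈ s, a y) = X' at *
  generalize p i / a i + p j / a j = Y at *
  generalize (∑ y ∈ s, p y / a y) = Y' at *
  have hcross : 2 * (u * u') ≤ X * Y' + X' * Y := by
    refine le_of_abs_le (abs_le_of_sq_le_sq ?_ (by positivity))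
    have h1 : u ^ 2 * u' ^ 2 ≤ (X * Y) * (X' * Y') :=
      mul_le_mul (by nlinarith [sq_nonneg (√(p i) - √(p j))]) hrest (sq_nonneg _)
        (mul_nonneg hX hY)
    nlinarith [sq_nonneg (X * Y' - X' * Y)]
  nlinarith

lemma sub_le_of_sq_sqrt_sub_le {x y t : ℝ} (hx : 0 ≤ x) (hy : 0 ≤ y) (hxy : x + y ≤ 1)
    (ht : t ∈ Set.Icc (0 : ℝ) 1) (h : (√x - √y) ^ 2 ≤ 1 - √(1 - t ^ 2)) : x - y ≤ t := by
  have hs := Real.sq_sqrt (show 0 ≤ 1 - t ^ 2 by nlinarith [ht.1, ht.2])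
  have hs0 := Real.sqrt_nonneg (1 - t ^ 2)
  refine le_of_abs_le (abs_le_of_sq_le_sq ?_ ht.1)
  have hx' := Real.sq_sqrt hx
  have hy' := Real.sq_sqrt hy
  have hfac : (x - y) ^ 2 = (√x - √y) ^ 2 * (√x + √y) ^ 2 := by
    rw [← mul_pow, mul_comm, ← sq_sub_sq, hx', hy']
  have hadd : (√x + √y) ^ 2 ≤ 2 - (√x - √y) ^ 2 := by nlinarith
  have hmul := mul_le_mul_of_nonneg_left hadd (sq_nonneg (√x - √y))
  rw [hfac]
  generalize (√x - √y) ^ 2 = d at *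
  nlinarith [mul_nonneg (sub_nonneg.2 h) (show 0 ≤ 1 + √(1 - t ^ 2) - d by linarith)]

lemma sum_sub_sum_le_card_mul {ι : Type*} [DecidableEq ι] {A B : Finset ι} {f : ι → ℝ} {t : ℝ}
    (ht : 0 ≤ t) (hcard : A.card = B.card) (h : ∀ i ∉ B, ∀ j ∈ B, f i - f j ≤ t) :
    ∑ i ∈ A, f i - ∑ j ∈ B, f j ≤ A.card * t := by
  have hcard' : (A \ B).card = (B \ A).card := Finset.card_sdiff_comm hcard
  rw [← Finset.sum_sdiff_sub_sum_sdiff]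
  rcases (B \ A).eq_empty_or_nonempty with he | hne
  · rw [he, Finset.card_empty, Finset.card_eq_zero] at hcard'
    rw [he, hcard']
    simpa using mul_nonneg A.card.cast_nonneg ht
  · obtain ⟨b, hb, hmin⟩ := Finset.exists_min_image (B \ A) f hne
    have hA : ∑ i ∈ A \ B, f i ≤ (A \ B).card • (f b + t) :=
      Finset.sum_le_card_nsmul _ _ _ fun i hi => by
        linarith [h i (Finset.mem_sdiff.1 hi).2 b (Finset.mem_sdiff.1 hb).1]
    have hB : (B \ A).card • f b ≤ ∑ j ∈ B \ A, f j := Finset.card_nsmul_le_sum _ _ _ hmin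
    rw [← hcard'] at hB
    have hle : ((A \ B).card : ℝ) ≤ A.card := by
      exact_mod_cast Finset.card_le_card Finset.sdiff_subset
    simp only [nsmul_eq_mul] at hA hB
    nlinarith [mul_le_mul_of_nonneg_right hle ht]


/-- Pointwise form of the paper's Theorem 1 for the sum-exponential loss: if the conditional
sum-exponential regret of the score vector `v` is at most `ψ t = 1 - √(1 - t²)`, then the
top-`k` conditional regret of `v` is at most `k * t`. -/
theorem topk_consistency_sum_exponential
    (n k : ℕ) (hn : 2 ≤ n) (hk1 : 1 ≤ k) (hkn : k ≤ n)
    (p : Fin n → ℝ) (hp : ∀ y, 0 ≤ p y) (hpsum : ∑ y, p y = 1)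
    (v : Fin n → ℝ)
    (σ : Equiv.Perm (Fin n)) (hσ : ∀ i j : Fin n, i ≤ j → p (σ j) ≤ p (σ i))
    (τ : Equiv.Perm (Fin n)) (hτ : ∀ i j : Fin n, i ≤ j → v (τ j) ≤ v (τ i)) :
    ∀ t ∈ Set.Icc (0 : ℝ) 1,
      (∑ y, p y * ∑ y' ∈ Finset.univ.erase y, Real.exp (v y' - v y))
          - (⨅ w : Fin n → ℝ, ∑ y, p y * ∑ y' ∈ Finset.univ.erase y, Real.exp (w y' - w y))
        ≤ 1 - Real.sqrt (1 - t ^ 2) →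
      ∑ i ∈ Finset.univ.filter (fun i : Fin n => (i : ℕ) < k), (p (σ i) - p (τ i))
        ≤ (k : ℝ) * t := by
  intro t ht hreg
  have hpair (i j : Fin n) (hij : v i ≤ v j) : p i - p j ≤ t := by
    rcases le_or_gt (p i) (p j) with hle | hlt
    · linarith [ht.1]
    have hne : i ≠ j := by rintro rfl; exact hlt.false
    refine sub_le_of_sq_sqrt_sub_le (hp i) (hp j) ?_ ht ?_
    · rw [← hpsum, ← Finset.sum_pair hne]
      exact Finset.sum_le_univ_sum_of_nonneg hp
    · have hlow := sq_sum_sqrt_add_sq_le hp (fun y => Real.exp_pos (v y)) hlt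
        (Real.exp_le_exp.2 hij)
      have hinf := iInf_sum_exp_risk_le hp hpsum
      rw [sum_exp_risk_eq hpsum v] at hreg
      linarith
  set s : Finset (Fin n) := Finset.univ.filter fun i : Fin n => (i : ℕ) < k
  have hs : s.card = k := by
    simp [s, Fin.card_filter_val_lt, hkn]
  have hmain := sum_sub_sum_le_card_mul (A := s.map σ.toEmbedding) (B := s.map τ.toEmbedding)
    (f := p) ht.1 (by simp) fun i hi j hj => by
      obtain ⟨j, hjs, rfl⟩ := Finset.mem_map.1 hj
      obtain ⟨i, rfl⟩ := τ.surjective i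
      have hi' : i ∉ s := fun h => hi (Finset.mem_map_of_mem τ.toEmbedding h)
      simp only [s, Finset.mem_filter, Finset.mem_univ, true_and, not_lt] at hi' hjs
      exact hpair _ _ (hτ j i (Fin.le_def.2 (hjs.le.trans hi')))
  rw [Finset.sum_sub_distrib]
  simpa [hs] using hmain
end

section
/- Let n ≥ 1 and m ≥ 2. Let p be a probability vector on Fin n, c : Fin m → Fin n → ℝ a cost function with 0 ≤ c k y ≤ 1 for all k, y, and set q̄(k) = ∑_y p y · (1 − c k y). Let r : Fin m → ℝ be a score vector and r̂ ∈ Fin m any index at which r attains its maximum. Let Δ = C(r) − inf { C(r') : r' : Fin m → ℝ }, where C(r') = −∑_k q̄(k)·log(S_{r'}(k)) and S_{r'}(k) = exp(r' k)/∑_{k'} exp(r' k'). Then (max_k q̄(k)) − q̄(r̂) ≤ 2·√Δ. -/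
lemma add_sq_div_two_le_neg_log_one_sub {x : ℝ} (hx0 : 0 ≤ x) (hx1 : x < 1) :
    x + x ^ 2 / 2 ≤ -Real.log (1 - x) := by
  have hsum := Real.hasSum_pow_div_log_of_abs_lt_one (abs_lt.2 ⟨by linarith, hx1⟩)
  have h := sum_le_hasSum (Finset.range 2) (fun i _ => by positivity) hsum
  norm_num [Finset.sum_range_succ] at h
  linarith

lemma sq_half_sub_le_log {a b : ℝ} (ha : a ≤ 1) (hb : 0 ≤ b) (hba : b ≤ a) :
    ((a - b) / 2) ^ 2 ≤
      a * Real.log (1 + (a - b) / 2) + b * Real.log (1 - (a - b) / 2) := by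
  obtain ⟨d, rfl⟩ : ∃ d, b = a - 2 * d := ⟨(a - b) / 2, by ring⟩
  have hd0 : 0 ≤ d := by linarith
  have hd1 : d ≤ 1 / 2 := by linarith
  have hpos : 0 < 1 - d ^ 2 := by nlinarith
  have hlog : Real.log (1 - d ^ 2) = Real.log (1 + d) + Real.log (1 - d) := by
    rw [← Real.log_mul (by linarith) (by linarith)]
    ring_nf
  have hquad := add_sq_div_two_le_neg_log_one_sub hd0 (by linarith)
  have hinv : -d ^ 2 - d ^ 3 ≤ 1 - (1 - d ^ 2)⁻¹ := by
    have : (1 - d ^ 2)⁻¹ ≤ 1 + d ^ 2 + d ^ 3 := by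
      rw [inv_le_iff_one_le_mul₀ hpos]
      have : 0 ≤ d ^ 3 * (1 - d - d ^ 2) := mul_nonneg (by positivity) (by nlinarith)
      nlinarith
    linarith
  have hlower := Real.one_sub_inv_le_log_of_pos hpos
  have hupper : Real.log (1 - d ^ 2) ≤ 0 := Real.log_nonpos hpos.le (by nlinarith)
  have hscale : Real.log (1 - d ^ 2) ≤ a * Real.log (1 - d ^ 2) := by nlinarith
  have hmul : 2 * d * (d + d ^ 2 / 2) ≤ 2 * d * -Real.log (1 - d) := by gcongr
  rw [show (a - (a - 2 * d)) / 2 = d by ring]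
  rw [hlog] at hlower hscale
  linarith

lemma add_div_two_le_log_exp_add_exp_div_two (u v : ℝ) :
    (u + v) / 2 ≤ Real.log ((Real.exp u + Real.exp v) / 2) := by
  rw [Real.le_log_iff_exp_le (by positivity)]
  have hu : Real.exp u = Real.exp (u / 2) ^ 2 := by rw [← Real.exp_nat_mul]; push_cast; ring_nf
  have hv : Real.exp v = Real.exp (v / 2) ^ 2 := by rw [← Real.exp_nat_mul]; push_cast; ring_nf
  rw [add_div, Real.exp_add, hu, hv]
  nlinarith [sq_nonneg (Real.exp (u / 2) - Real.exp (v / 2))]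

section LogisticRisk

variable {ι : Type*} [Fintype ι]

/-- The conditional error of the logistic loss with weights `q` at the score vector `r`. -/
noncomputable def logisticRisk (q r : ι → ℝ) : ℝ :=
  -∑ k, q k * Real.log (Real.exp (r k) / ∑ k', Real.exp (r k'))

lemma logisticRisk_nonneg {q : ι → ℝ} (hq : ∀ k, 0 ≤ q k) (r : ι → ℝ) :
    0 ≤ logisticRisk q r := by
  refine neg_nonneg.2 (Finset.sum_nonpos fun k _ => mul_nonpos_of_nonneg_of_nonpos (hq k) ?_)
  refine Real.log_nonpos (by positivity) (div_le_one_of_le₀ ?_ (by positivity))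
  exact Finset.single_le_sum (f := fun k => Real.exp (r k))
    (fun _ _ => (Real.exp_pos _).le) (Finset.mem_univ k)

lemma logisticRisk_sub_eq [Nonempty ι] (q : ι → ℝ) {r r' : ι → ℝ}
    (h : ∑ k, Real.exp (r' k) = ∑ k, Real.exp (r k)) :
    logisticRisk q r - logisticRisk q r' = ∑ k, q k * (r' k - r k) := by
  have hZ : ∑ k, Real.exp (r k) ≠ 0 := by positivity
  simp only [logisticRisk, h, Real.log_div (Real.exp_ne_zero _) hZ, Real.log_exp]
  rw [neg_sub_neg, ← Finset.sum_sub_distrib]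
  exact Finset.sum_congr rfl fun k _ => by ring

/-- Replacing the scores `r i`, `r j` by `x`, `y` with `exp x + exp y = exp (r i) + exp (r j)`
changes the logistic risk only through these two coordinates. -/
lemma exists_logisticRisk_sub_eq (q r : ι → ℝ) {i j : ι} (hij : i ≠ j) {x y : ℝ}
    (hxy : Real.exp x + Real.exp y = Real.exp (r i) + Real.exp (r j)) :
    ∃ r', logisticRisk q r - logisticRisk q r' = q i * (x - r i) + q j * (y - r j) := by
  classical
  have : Nonempty ι := ⟨i⟩
  let r' := Function.update (Function.update r i x) j y
  have hi : r' i = x := by simp [r', hij]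
  have hj : r' j = y := by simp [r']
  have hk : ∀ k, k ≠ i ∧ k ≠ j → r' k = r k := fun k hk => by simp [r', hk.1, hk.2]
  refine ⟨r', ?_⟩
  rw [logisticRisk_sub_eq, Fintype.sum_eq_add i j hij, hi, hj]
  · intro k hk'
    rw [hk k hk', sub_self, mul_zero]
  · rw [← sub_eq_zero, ← Finset.sum_sub_distrib, Fintype.sum_eq_add i j hij, hi, hj]
    · linarith
    · intro k hk'
      rw [hk k hk', sub_self]

lemma exists_sq_half_sub_le_logisticRisk_sub {q r : ι → ℝ} {i j : ι} (hi : q i ≤ 1)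
    (hj : 0 ≤ q j) (hq : q j ≤ q i) (hr : r i ≤ r j) :
    ∃ r', ((q i - q j) / 2) ^ 2 ≤ logisticRisk q r - logisticRisk q r' := by
  rcases eq_or_ne i j with rfl | hij
  · exact ⟨r, by simp⟩
  set d := (q i - q j) / 2 with hd
  set w := (Real.exp (r i) + Real.exp (r j)) / 2 with hw
  have hwpos : 0 < w := by positivity
  have hplus : 0 < 1 + d := by linarith
  have hminus : 0 < 1 - d := by linarith
  obtain ⟨r', hr'⟩ := exists_logisticRisk_sub_eq q r hij
    (x := Real.log (w * (1 + d))) (y := Real.log (w * (1 - d))) (by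
      rw [Real.exp_log (by positivity), Real.exp_log (by positivity)]
      linarith)
  refine ⟨r', ?_⟩
  rw [hr', Real.log_mul hwpos.ne' hplus.ne', Real.log_mul hwpos.ne' hminus.ne']
  have hlog := sq_half_sub_le_log hi hj hq
  have hmid : (q i + q j) * ((r i + r j) / 2) ≤ (q i + q j) * Real.log w := by
    gcongr
    · linarith
    · exact add_div_two_le_log_exp_add_exp_div_two _ _
  have hord : 0 ≤ (q i - q j) * (r j - r i) :=
    mul_nonneg (by linarith) (by linarith)
  rw [← hd] at hlog
  linarith

lemma sub_le_two_mul_sqrt_logisticRisk_sub_iInf {q r : ι → ℝ} (hq0 : ∀ k, 0 ≤ q k)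
    {i j : ι} (hi : q i ≤ 1) (hr : r i ≤ r j) :
    q i - q j ≤ 2 * √(logisticRisk q r - ⨅ r', logisticRisk q r') := by
  rcases le_total (q i) (q j) with hq | hq
  · linarith [Real.sqrt_nonneg (logisticRisk q r - ⨅ r', logisticRisk q r')]
  obtain ⟨r', hr'⟩ := exists_sq_half_sub_le_logisticRisk_sub hi (hq0 j) hq hr
  have hbdd : BddBelow (Set.range (logisticRisk q)) :=
    ⟨0, Set.forall_mem_range.2 (logisticRisk_nonneg hq0)⟩
  have hsqrt := Real.le_sqrt_of_sq_le (hr'.trans (sub_le_sub_left (ciInf_le hbdd r') _))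
  linarith

end LogisticRisk


/-- Pointwise form of the paper's Theorem 2 for the cost-sensitive logistic loss: the
conditional regret of the cardinality-aware target loss is at most `2 √Δ`, where `Δ` is the
conditional regret of the cost-sensitive logistic loss. -/
theorem cardinality_aware_consistency_cost_logistic
    (n m : ℕ) (hn : 1 ≤ n) (hm : 2 ≤ m)
    (p : Fin n → ℝ) (hp : ∀ y, 0 ≤ p y) (hpsum : ∑ y, p y = 1)
    (c : Fin m → Fin n → ℝ) (hc : ∀ k y, 0 ≤ c k y ∧ c k y ≤ 1)
    (r : Fin m → ℝ) (rhat : Fin m) (hrhat : ∀ k, r k ≤ r rhat)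
    (Δ : ℝ)
    (hΔ : Δ = (-∑ k, (∑ y, p y * (1 - c k y)) *
            Real.log (Real.exp (r k) / ∑ k', Real.exp (r k')))
        - ⨅ r' : Fin m → ℝ, -∑ k, (∑ y, p y * (1 - c k y)) *
            Real.log (Real.exp (r' k) / ∑ k', Real.exp (r' k'))) :
    (⨆ k : Fin m, ∑ y, p y * (1 - c k y)) - (∑ y, p y * (1 - c rhat y))
      ≤ 2 * Real.sqrt Δ := by
  have : Nonempty (Fin m) := ⟨rhat⟩
  have hq0 : ∀ k, 0 ≤ ∑ y, p y * (1 - c k y) := fun k =>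
    Finset.sum_nonneg fun y _ => mul_nonneg (hp y) (sub_nonneg.2 (hc k y).2)
  have hq1 : ∀ k, ∑ y, p y * (1 - c k y) ≤ 1 := fun k =>
    hpsum ▸ Finset.sum_le_sum fun y _ => mul_le_of_le_one_right (hp y) (by linarith [(hc k y).1])
  rw [hΔ, sub_le_iff_le_add]
  refine ciSup_le fun k => sub_le_iff_le_add.1 ?_
  exact sub_le_two_mul_sqrt_logisticRisk_sub_iInf
    (q := fun k => ∑ y, p y * (1 - c k y)) hq0 (hq1 k) (hrhat k)
end

section
/- Let n ≥ 1 and m ≥ 2. Let p be a probability vector on Fin n, c : Fin m → Fin n → ℝ a cost function with 0 ≤ c k y ≤ 1 for all k, y, and set q̄(k) = ∑_y p y · (1 − c k y). Let r : Fin m → ℝ be a score vector and r̂ ∈ Fin m any index at which r attains its maximum. Let Δ = C(r) − inf { C(r') : r' : Fin m → ℝ }, where C(r') = ∑_k q̄(k)·∑_{k' ≠ k} exp(r' k' − r' k). Then (max_k q̄(k)) − q̄(r̂) ≤ 2·√Δ. -/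
/-- Summing `exp (r k' - r k)` over `k' ≠ k` in terms of the total mass `∑ exp (r k')`. -/
theorem sum_erase_exp_sub {ι : Type*} [Fintype ι] [DecidableEq ι] (r : ι → ℝ) (k : ι) :
    ∑ k' ∈ Finset.univ.erase k, Real.exp (r k' - r k)
      = (∑ k', Real.exp (r k')) / Real.exp (r k) - 1 := by
  have h := Finset.add_sum_erase Finset.univ (fun k' => Real.exp (r k' - r k)) (Finset.mem_univ k)
  simp only [sub_self, Real.exp_zero] at h
  rw [Finset.sum_div]
  simp only [← Real.exp_sub]
  linarith

/-- If `y ≤ x` and `u ≤ v ≤ 1`, moving the total mass `x + y` towards the coordinate of `v`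
decreases `u / x + v / y` by at least `(v - u) ^ 2 / (4 (x + y))`. -/
theorem sq_sub_div_four_le_gain {u v x y : ℝ} (hu : 0 ≤ u) (huv : u ≤ v) (hv : v ≤ 1)
    (hy : 0 < y) (hyx : y ≤ x) :
    (v - u) ^ 2 / 4 ≤ (x + y) * (u * (1 / x - 1 / ((x + y) * (1 - (v - u) / 4) / 2))
      + v * (1 / y - 1 / ((x + y) * (1 + (v - u) / 4) / 2))) := by
  have hx : 0 < x := hy.trans_le hyx
  obtain ⟨d, hd⟩ : ∃ d, d = (v - u) / 4 := ⟨_, rfl⟩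
  rw [← hd]
  have hd0 : 0 ≤ d := by linarith
  have hd1 : d ≤ 1 / 4 := by linarith
  have hl : 0 < 1 - d := by linarith
  have hr : 0 < 1 + d := by linarith
  have hbal : 2 * (u + v) ≤ (x + y) * (u / x + v / y) := by
    have : (x + y) * (u / x + v / y) - 2 * (u + v)
        = (x - y) * ((v - u) * x + u * (x - y)) / (x * y) := by
      field_simp
      ring
    have : 0 ≤ (x - y) * ((v - u) * x + u * (x - y)) / (x * y) := by
      have h1 : 0 ≤ x - y := by linarith
      have h2 : 0 ≤ v - u := by linarith
      positivity
    linarith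
  have hshift : (v - u) ^ 2 / 4 ≤ 2 * (u + v) - 2 * (u / (1 - d) + v / (1 + d)) := by
    have : 2 * (u + v) - 2 * (u / (1 - d) + v / (1 + d))
        = 2 * d * (v - u - d * (u + v)) / ((1 - d) * (1 + d)) := by
      field_simp
      ring
    rw [this, le_div_iff₀ (by positivity)]
    have h1 : d * (u + v) ≤ d * 2 := mul_le_mul_of_nonneg_left (by linarith) hd0
    have h2 : 2 * d * (2 * d) ≤ 2 * d * (v - u - d * (u + v)) :=
      mul_le_mul_of_nonneg_left (by linarith) (by linarith)
    have h3 : v - u = 4 * d := by linarith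
    rw [h3] at h2 ⊢
    nlinarith [sq_nonneg (d ^ 2)]
  have hexp : (x + y) * (u * (1 / x - 1 / ((x + y) * (1 - d) / 2))
      + v * (1 / y - 1 / ((x + y) * (1 + d) / 2)))
      = (x + y) * (u / x + v / y) - 2 * (u / (1 - d) + v / (1 + d)) := by
    have hxy : x + y ≠ 0 := by positivity
    field_simp
    ring
  rw [hexp]
  linarith

/-- If `r` ranks `a` at least as high as `b` although `q a ≤ q b`, then some other score vector
improves the sum-exponential conditional error by at least `(q b - q a) ^ 2 / 4`. -/
theorem exists_sum_exp_add_sq_le {ι : Type*} [Fintype ι] [DecidableEq ι] {q : ι → ℝ}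
    (hq0 : ∀ k, 0 ≤ q k) (hq1 : ∀ k, q k ≤ 1) (r : ι → ℝ) {a b : ι} (hab : q a < q b)
    (hr : r b ≤ r a) :
    ∃ r' : ι → ℝ,
      ∑ k, q k * ∑ k' ∈ Finset.univ.erase k, Real.exp (r' k' - r' k) + (q b - q a) ^ 2 / 4
        ≤ ∑ k, q k * ∑ k' ∈ Finset.univ.erase k, Real.exp (r k' - r k) := by
  have hne : a ≠ b := by
    rintro rfl
    exact lt_irrefl _ hab
  set x := Real.exp (r a)
  set y := Real.exp (r b)
  have hx0 : 0 < x := Real.exp_pos _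
  have hy0 : 0 < y := Real.exp_pos _
  have hgain := sq_sub_div_four_le_gain (hq0 a) hab.le (hq1 b) hy0 (Real.exp_le_exp.2 hr : y ≤ x)
  set X := (x + y) * (1 - (q b - q a) / 4) / 2 with hX
  set Y := (x + y) * (1 + (q b - q a) / 4) / 2 with hY
  have hX0 : 0 < X := by
    have : 0 < 1 - (q b - q a) / 4 := by linarith [hq0 a, hq1 b]
    positivity
  have hY0 : 0 < Y := by
    have : 0 < 1 + (q b - q a) / 4 := by linarith
    positivity
  let r' : ι → ℝ := fun k => if k = a then Real.log X else if k = b then Real.log Y else r k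
  have ha' : Real.exp (r' a) = X := by simp [r', Real.exp_log hX0]
  have hb' : Real.exp (r' b) = Y := by simp [r', hne.symm, Real.exp_log hY0]
  have ho' : ∀ k, k ≠ a ∧ k ≠ b → r' k = r k := fun k hk => by simp [r', hk.1, hk.2]
  have hmass : ∑ k, Real.exp (r' k) = ∑ k, Real.exp (r k) := by
    rw [← sub_eq_zero, ← Finset.sum_sub_distrib,
      Fintype.sum_eq_add a b hne (fun k hk => by rw [ho' k hk, sub_self]), ha', hb', hX, hY]
    ring
  have hle : x + y ≤ ∑ k, Real.exp (r k) := by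
    rw [← Finset.sum_pair (f := fun k => Real.exp (r k)) hne]
    exact Finset.sum_le_sum_of_subset_of_nonneg (Finset.subset_univ _)
      fun _ _ _ => (Real.exp_pos _).le
  refine ⟨r', ?_⟩
  simp only [sum_erase_exp_sub, hmass]
  set S := ∑ k, Real.exp (r k)
  set G := q a * (1 / x - 1 / X) + q b * (1 / y - 1 / Y)
  have hdiff : ∑ k, q k * (S / Real.exp (r k) - 1) - ∑ k, q k * (S / Real.exp (r' k) - 1)
      = S * G := by
    rw [← Finset.sum_sub_distrib,
      Fintype.sum_eq_add a b hne (fun k hk => by rw [ho' k hk, sub_self]), ha', hb']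
    simp only [G]
    ring
  have hG : 0 ≤ G := nonneg_of_mul_nonneg_right ((by positivity : (0 : ℝ) ≤ _).trans hgain)
    (add_pos hx0 hy0)
  linarith [mul_le_mul_of_nonneg_right hle hG]


/-- Pointwise form of the paper's Theorem 2 for the cost-sensitive sum-exponential loss: the
conditional regret of the cardinality-aware target loss is at most `2 √Δ`, where `Δ` is the
conditional regret of the cost-sensitive sum-exponential loss. -/
theorem cardinality_aware_consistency_cost_sum_exponential
    (n m : ℕ) (hn : 1 ≤ n) (hm : 2 ≤ m)
    (p : Fin n → ℝ) (hp : ∀ y, 0 ≤ p y) (hpsum : ∑ y, p y = 1)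
    (c : Fin m → Fin n → ℝ) (hc : ∀ k y, 0 ≤ c k y ∧ c k y ≤ 1)
    (r : Fin m → ℝ) (rhat : Fin m) (hrhat : ∀ k, r k ≤ r rhat)
    (Δ : ℝ)
    (hΔ : Δ = (∑ k, (∑ y, p y * (1 - c k y)) *
            ∑ k' ∈ Finset.univ.erase k, Real.exp (r k' - r k))
        - ⨅ r' : Fin m → ℝ, ∑ k, (∑ y, p y * (1 - c k y)) *
            ∑ k' ∈ Finset.univ.erase k, Real.exp (r' k' - r' k)) :
    (⨆ k : Fin m, ∑ y, p y * (1 - c k y)) - (∑ y, p y * (1 - c rhat y))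
      ≤ 2 * Real.sqrt Δ := by
  set q : Fin m → ℝ := fun k => ∑ y, p y * (1 - c k y)
  have hq0 : ∀ k, 0 ≤ q k := fun k =>
    Finset.sum_nonneg fun y _ => mul_nonneg (hp y) (by linarith [(hc k y).2])
  have hq1 : ∀ k, q k ≤ 1 := fun k => hpsum ▸
    Finset.sum_le_sum fun y _ => mul_le_of_le_one_right (hp y) (by linarith [(hc k y).1])
  have : Nonempty (Fin m) := ⟨rhat⟩
  change (⨆ k, q k) - q rhat ≤ _
  rw [sub_le_iff_le_add]
  refine ciSup_le fun b => ?_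
  rw [← sub_le_iff_le_add]
  rcases le_or_gt (q b) (q rhat) with h | h
  · linarith [Real.sqrt_nonneg Δ]
  obtain ⟨r', hr'⟩ := exists_sum_exp_add_sq_le hq0 hq1 r h (hrhat b)
  have hbdd : BddBelow (Set.range fun r' : Fin m → ℝ =>
      ∑ k, q k * ∑ k' ∈ Finset.univ.erase k, Real.exp (r' k' - r' k)) := by
    refine ⟨0, ?_⟩
    rintro _ ⟨s, rfl⟩
    exact Finset.sum_nonneg fun k _ =>
      mul_nonneg (hq0 k) (Finset.sum_nonneg fun _ _ => (Real.exp_pos _).le)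
  have hinf := ciInf_le hbdd r'
  have hsq : ((q b - q rhat) / 2) ^ 2 ≤ Δ := by
    rw [hΔ]
    linarith
  linarith [Real.le_sqrt_of_sq_le hsq]
end

section
/- Let n ≥ 1, m ≥ 2, and q ∈ (0,1). Let p be a probability vector on Fin n, c : Fin m → Fin n → ℝ a cost function with 0 ≤ c k y ≤ 1 for all k, y, and set q̄(k) = ∑_y p y · (1 − c k y). Let r : Fin m → ℝ be a score vector and r̂ ∈ Fin m any index at which r attains its maximum. Let Δ = C(r) − inf { C(r') : r' : Fin m → ℝ }, where C(r') = (1/q)·∑_k q̄(k)·(1 − (S_{r'}(k))^q) and S_{r'}(k) = exp(r' k)/∑_{k'} exp(r' k'). Then (max_k q̄(k)) − q̄(r̂) ≤ 2·√(m^q · Δ). -/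
section

open Real Set

/-- Bernoulli's inequality for nonpositive exponents. -/
lemma one_add_mul_self_le_rpow_one_add_of_nonpos {s p : ℝ} (hs : -1 < s) (hp : p ≤ 0) :
    1 + p * s ≤ (1 + s) ^ p := by
  have hs' : 0 < 1 + s := by linarith
  rw [rpow_def_of_pos hs']
  have h1 := add_one_le_exp (log (1 + s) * p)
  have h2 := mul_le_mul_of_nonpos_right (log_le_sub_one_of_pos hs') hp
  linarith

/-- The odd part of `x ↦ (1 + x) ^ q` dominates its linearization on `[0, 1]`. -/
lemma two_mul_mul_le_rpow_one_add_sub_rpow_one_sub {q x : ℝ} (hq : q ∈ Ioo (0 : ℝ) 1)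
    (hx : x ∈ Icc (0 : ℝ) 1) : 2 * q * x ≤ (1 + x) ^ q - (1 - x) ^ q := by
  obtain ⟨hq0, hq1⟩ := hq
  let f : ℝ → ℝ := fun t => (1 + t) ^ q - (1 - t) ^ q - 2 * q * t
  have hderiv : ∀ t ∈ interior (Icc (0 : ℝ) 1), HasDerivAt f
      (q * ((1 + t) ^ (q - 1) + (1 - t) ^ (q - 1) - 2)) t := by
    intro t ht
    rw [interior_Icc] at ht
    have h1 := ((hasDerivAt_id t).const_add 1).rpow_const (p := q)
      (Or.inl (by simp only [id]; linarith [ht.1]))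
    have h2 := ((hasDerivAt_id t).const_sub 1).rpow_const (p := q)
      (Or.inl (by simp only [id]; linarith [ht.2]))
    refine ((h1.sub h2).sub ((hasDerivAt_id t).const_mul (2 * q))).congr_deriv ?_
    simp only [id]
    ring
  have hmono : MonotoneOn f (Icc 0 1) := by
    refine monotoneOn_of_deriv_nonneg (convex_Icc 0 1) ?_
      (fun t ht => (hderiv t ht).differentiableAt.differentiableWithinAt) ?_
    · have : Continuous f := by
        have h1 : Continuous fun t : ℝ => (1 + t) ^ q :=
          (continuous_const.add continuous_id).rpow_const fun _ => Or.inr hq0.le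
        have h2 : Continuous fun t : ℝ => (1 - t) ^ q :=
          (continuous_const.sub continuous_id).rpow_const fun _ => Or.inr hq0.le
        exact (h1.sub h2).sub (by fun_prop)
      exact this.continuousOn
    · intro t ht
      rw [(hderiv t ht).deriv]
      rw [interior_Icc] at ht
      have h1 := one_add_mul_self_le_rpow_one_add_of_nonpos (s := t) (p := q - 1)
        (by linarith [ht.1]) (by linarith)
      have h2 := one_add_mul_self_le_rpow_one_add_of_nonpos (s := -t) (p := q - 1)
        (by linarith [ht.2]) (by linarith)
      rw [← sub_eq_add_neg] at h2
      exact mul_nonneg hq0.le (by linarith)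
  have := hmono (left_mem_Icc.2 zero_le_one) hx hx.1
  simp only [f, add_zero, sub_zero, one_rpow, mul_zero, sub_self] at this
  linarith

/-- Twice the even part of `x ↦ (1 + x) ^ (1 + q)` dominates its second-order expansion. -/
lemma two_add_mul_sq_le_rpow_one_add_add_rpow_one_sub {q x : ℝ} (hq : q ∈ Ioo (0 : ℝ) 1)
    (hx : x ∈ Icc (0 : ℝ) 1) :
    2 + (1 + q) * q * x ^ 2 ≤ (1 + x) ^ (1 + q) + (1 - x) ^ (1 + q) := by
  have hq0 := hq.1
  let f : ℝ → ℝ := fun t => (1 + t) ^ (1 + q) + (1 - t) ^ (1 + q) - (1 + q) * q * t ^ 2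
  have hderiv : ∀ t, HasDerivAt f ((1 + q) * ((1 + t) ^ q - (1 - t) ^ q - 2 * q * t)) t := by
    intro t
    have h1 := ((hasDerivAt_id t).const_add 1).rpow_const (p := 1 + q) (Or.inr (by linarith))
    have h2 := ((hasDerivAt_id t).const_sub 1).rpow_const (p := 1 + q) (Or.inr (by linarith))
    refine ((h1.add h2).sub ((hasDerivAt_pow 2 t).const_mul ((1 + q) * q))).congr_deriv ?_
    simp only [id, add_sub_cancel_left]
    push_cast
    ring
  have hmono : MonotoneOn f (Icc 0 1) := by
    refine monotoneOn_of_deriv_nonneg (convex_Icc 0 1)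
      (fun t _ => (hderiv t).continuousAt.continuousWithinAt)
      (fun t _ => (hderiv t).differentiableAt.differentiableWithinAt) fun t ht => ?_
    rw [(hderiv t).deriv]
    have := two_mul_mul_le_rpow_one_add_sub_rpow_one_sub hq (interior_subset ht)
    exact mul_nonneg (by linarith) (by linarith)
  have := hmono (left_mem_Icc.2 zero_le_one) hx hx.1
  simp only [f, add_zero, sub_zero, one_rpow] at this
  linarith

/-- Weighted power sums with the larger weight on the smaller mass are at most the value at equal
masses. -/
lemma mul_rpow_add_mul_rpow_le {q a b s t : ℝ} (hq : q ∈ Ioo (0 : ℝ) 1) (hb : 0 ≤ b)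
    (hab : b ≤ a) (ht : 0 < t) (hts : t ≤ s) :
    a * t ^ q + b * s ^ q ≤ ((s + t) / 2) ^ q * (a + b) := by
  have hσ : 0 < (s + t) / 2 := by linarith
  set y := (s - t) / (s + t) with hy
  have hy0 : 0 ≤ y := div_nonneg (by linarith) (by linarith)
  have hy1 : y ≤ 1 := div_le_one_of_le₀ (by linarith) (by linarith)
  have hne : s + t ≠ 0 := by linarith
  have ht' : t = (s + t) / 2 * (1 + -y) := by rw [hy]; field_simp; ring
  have hs' : s = (s + t) / 2 * (1 + y) := by rw [hy]; field_simp; ring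
  have et : t ^ q = ((s + t) / 2) ^ q * (1 + -y) ^ q := by
    rw [← mul_rpow hσ.le (by linarith), ← ht']
  have es : s ^ q = ((s + t) / 2) ^ q * (1 + y) ^ q := by
    rw [← mul_rpow hσ.le (by linarith), ← hs']
  have h1 := rpow_one_add_le_one_add_mul_self (s := -y) (by linarith) hq.1.le hq.2.le
  have h2 := rpow_one_add_le_one_add_mul_self (s := y) (by linarith) hq.1.le hq.2.le
  have h3 : 0 ≤ ((s + t) / 2) ^ q := rpow_nonneg hσ.le q
  have h4 := mul_le_mul_of_nonneg_left h1 (hb.trans hab)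
  have h5 := mul_le_mul_of_nonneg_left h2 hb
  have h6 : 0 ≤ (a - b) * (q * y) := mul_nonneg (by linarith) (mul_nonneg hq.1.le hy0)
  rw [et, es]
  calc _ = ((s + t) / 2) ^ q * (a * (1 + -y) ^ q + b * (1 + y) ^ q) := by ring
    _ ≤ _ := mul_le_mul_of_nonneg_left (by linarith) h3

/-- Splitting a mass `σ` proportionally to the weights `a` and `b` beats the even split by a
quadratic margin. -/
lemma quadratic_margin_of_proportional_split {q a b σ : ℝ} (hq : q ∈ Ioo (0 : ℝ) 1)
    (hb : 0 ≤ b) (hab : b < a) (ha : a ≤ 1) (hσ : 0 ≤ σ) :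
    σ ^ q * (q * ((a - b) / 2) ^ 2) ≤
      a * (σ / 2 * (1 + (a - b) / (a + b))) ^ q + b * (σ / 2 * (1 - (a - b) / (a + b))) ^ q
        - (σ / 2) ^ q * (a + b) := by
  have hx : 0 < a + b := by linarith
  have hx' : a + b ≠ 0 := hx.ne'
  set e := (a - b) / (a + b) with he
  have he0 : 0 ≤ e := div_nonneg (by linarith) hx.le
  have he1 : e ≤ 1 := div_le_one_of_le₀ (by linarith) hx.le
  have key := two_add_mul_sq_le_rpow_one_add_add_rpow_one_sub hq ⟨he0, he1⟩
  rw [rpow_add_of_nonneg (by linarith) zero_le_one hq.1.le,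
    rpow_add_of_nonneg (by linarith) zero_le_one hq.1.le, rpow_one, rpow_one] at key
  have hA : a = (a + b) / 2 * (1 + e) := by rw [he]; field_simp; ring
  have hB : b = (a + b) / 2 * (1 - e) := by rw [he]; field_simp; ring
  have hD : (a - b) / 2 = (a + b) / 2 * e := by rw [he]; field_simp
  rw [mul_rpow (by linarith) (by linarith), mul_rpow (by linarith) (by linarith)]
  have h2 : (2 : ℝ) ^ q ≤ 1 + q := by
    have := rpow_one_add_le_one_add_mul_self (s := 1) (by norm_num) hq.1.le hq.2.le
    norm_num at this
    linarith
  have hσ2 : σ ^ q = (σ / 2) ^ q * 2 ^ q := by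
    rw [← mul_rpow (by linarith) (by norm_num)]; congr 1; ring
  have hP : 0 ≤ (σ / 2) ^ q := rpow_nonneg (by linarith) q
  have hx1 : (a + b) / 2 ≤ 1 := by linarith
  have hxe : ((a - b) / 2) ^ 2 ≤ (a + b) / 2 * e ^ 2 := by
    rw [hD, mul_pow]
    refine mul_le_mul_of_nonneg_right ?_ (sq_nonneg e)
    nlinarith
  have hE : a * (1 + e) ^ q + b * (1 - e) ^ q - (a + b) =
      (a + b) / 2 * ((1 + e) * (1 + e) ^ q + (1 - e) * (1 - e) ^ q - 2) := by
    linear_combination (1 + e) ^ q * hA + (1 - e) ^ q * hB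
  have hfin : 2 ^ q * (q * ((a - b) / 2) ^ 2) ≤
      a * (1 + e) ^ q + b * (1 - e) ^ q - (a + b) := by
    rw [hE]
    calc _ ≤ (1 + q) * (q * ((a + b) / 2 * e ^ 2)) :=
          mul_le_mul h2 (mul_le_mul_of_nonneg_left hxe hq.1.le)
            (mul_nonneg hq.1.le (sq_nonneg _)) (by linarith [hq.1])
      _ = (a + b) / 2 * ((1 + q) * q * e ^ 2) := by ring
      _ ≤ _ := mul_le_mul_of_nonneg_left (by linarith) (by linarith)
  calc _ = (σ / 2) ^ q * (2 ^ q * (q * ((a - b) / 2) ^ 2)) := by rw [hσ2]; ring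
    _ ≤ (σ / 2) ^ q * (a * (1 + e) ^ q + b * (1 - e) ^ q - (a + b)) :=
        mul_le_mul_of_nonneg_left hfin hP
    _ = _ := by ring

/-- A positive probability vector is the softmax of its coordinatewise logarithm. -/
lemma exp_log_div_sum_exp_log {ι : Type*} [Fintype ι] {T : ι → ℝ} (hT : ∀ k, 0 < T k)
    (hsum : ∑ k, T k = 1) (k : ι) : exp (log (T k)) / ∑ k', exp (log (T k')) = T k := by
  simp only [exp_log (hT _), hsum, div_one]

/-- If `S` is a positive probability vector, moving mass between two coordinates `i` and `j` bounds
from below the suboptimality of the generalized cross-entropy at `S`. -/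
lemma gce_pair_gain_le {ι : Type*} [Fintype ι] {q D : ℝ} (hq : 0 < q)
    {w S : ι → ℝ} (hS : ∀ k, 0 < S k) (hsum : ∑ k, S k = 1) {i j : ι} (hij : i ≠ j)
    (hD : ∀ T : ι → ℝ, (∀ k, 0 < T k) → ∑ k, T k = 1 →
      1 / q * ∑ k, w k * (1 - S k ^ q) - 1 / q * ∑ k, w k * (1 - T k ^ q) ≤ D)
    {x : ℝ} (hx : x ∈ Icc (-1 : ℝ) 1) :
    w i * ((S j + S i) / 2 * (1 + x)) ^ q + w j * ((S j + S i) / 2 * (1 - x)) ^ q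
      ≤ q * D + (w i * S i ^ q + w j * S j ^ q) := by
  classical
  have hσ : 0 < (S j + S i) / 2 := by linarith [hS i, hS j]
  set h := (S j + S i) / 2 with hh
  rw [← closure_Ioo (by norm_num : (-1 : ℝ) ≠ 1)] at hx
  refine le_on_closure (f := fun x : ℝ => w i * (h * (1 + x)) ^ q + w j * (h * (1 - x)) ^ q)
    (g := fun _ => q * D + (w i * S i ^ q + w j * S j ^ q)) ?_ ?_ continuousOn_const hx
  · intro x hx
    let T : ι → ℝ := Function.update (Function.update S i (h * (1 + x))) j (h * (1 - x))
    have hTj : T j = h * (1 - x) := by simp [T]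
    have hTi : T i = h * (1 + x) := by simp [T, hij]
    have hTk : ∀ k, k ≠ i ∧ k ≠ j → T k = S k := fun k hk => by simp [T, hk.1, hk.2]
    have hTpos : ∀ k, 0 < T k := by
      intro k
      by_cases hki : k = i
      · subst hki; rw [hTi]; exact mul_pos hσ (by linarith [hx.1])
      by_cases hkj : k = j
      · subst hkj; rw [hTj]; exact mul_pos hσ (by linarith [hx.2])
      rw [hTk k ⟨hki, hkj⟩]; exact hS k
    have hdiff : ∀ F : ι → ℝ → ℝ, ∑ k, F k (T k) - ∑ k, F k (S k) =
        (F i (T i) - F i (S i)) + (F j (T j) - F j (S j)) := by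
      intro F
      rw [← Finset.sum_sub_distrib]
      exact Finset.sum_eq_add i j hij (fun k _ hk => by rw [hTk k hk, sub_self])
        (fun hn => absurd (Finset.mem_univ _) hn) (fun hn => absurd (Finset.mem_univ _) hn)
    have hTsum : ∑ k, T k = 1 := by
      have := hdiff fun _ t => t
      simp only [hTi, hTj, hsum] at this
      linarith
    have hgain := hD T hTpos hTsum
    have hdw := hdiff fun k t => w k * (1 - t ^ q)
    simp only [hTi, hTj] at hdw
    rw [← mul_sub, one_div_mul_eq_div, div_le_iff₀ hq] at hgain
    show w i * (h * (1 + x)) ^ q + w j * (h * (1 - x)) ^ q ≤ _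
    linarith
  · have h1 : Continuous fun x : ℝ => (h * (1 + x)) ^ q :=
      (by fun_prop : Continuous fun x : ℝ => h * (1 + x)).rpow_const fun _ => Or.inr hq.le
    have h2 : Continuous fun x : ℝ => (h * (1 - x)) ^ q :=
      (by fun_prop : Continuous fun x : ℝ => h * (1 - x)).rpow_const fun _ => Or.inr hq.le
    exact ((h1.const_mul _).add (h2.const_mul _)).continuousOn

end

/-- Pointwise form of the paper's Theorem 2 for the cost-sensitive generalized cross-entropy
loss with parameter `q ∈ (0,1)`: the conditional regret of the cardinality-aware target loss
is at most `2 √(m^q Δ)`, where `Δ` is the conditional regret of the cost-sensitive GCE loss. -/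
theorem cardinality_aware_consistency_cost_gce
    (n m : ℕ) (hn : 1 ≤ n) (hm : 2 ≤ m)
    (q : ℝ) (hq : q ∈ Set.Ioo (0 : ℝ) 1)
    (p : Fin n → ℝ) (hp : ∀ y, 0 ≤ p y) (hpsum : ∑ y, p y = 1)
    (c : Fin m → Fin n → ℝ) (hc : ∀ k y, 0 ≤ c k y ∧ c k y ≤ 1)
    (r : Fin m → ℝ) (rhat : Fin m) (hrhat : ∀ k, r k ≤ r rhat)
    (Δ : ℝ)
    (hΔ : Δ = ((1 / q) * ∑ k, (∑ y, p y * (1 - c k y)) *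
            (1 - (Real.exp (r k) / ∑ k', Real.exp (r k')) ^ q))
        - ⨅ r' : Fin m → ℝ, (1 / q) * ∑ k, (∑ y, p y * (1 - c k y)) *
            (1 - (Real.exp (r' k) / ∑ k', Real.exp (r' k')) ^ q)) :
    (⨆ k : Fin m, ∑ y, p y * (1 - c k y)) - (∑ y, p y * (1 - c rhat y))
      ≤ 2 * Real.sqrt ((m : ℝ) ^ q * Δ) := by
  have hq0 := hq.1
  have : Nonempty (Fin m) := ⟨rhat⟩
  set w : Fin m → ℝ := fun k => ∑ y, p y * (1 - c k y) with hw
  have hw0 : ∀ k, 0 ≤ w k := fun k =>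
    Finset.sum_nonneg fun y _ => mul_nonneg (hp y) (by linarith [(hc k y).2])
  have hw1 : ∀ k, w k ≤ 1 := fun k => hpsum ▸
    Finset.sum_le_sum fun y _ => mul_le_of_le_one_right (hp y) (by linarith [(hc k y).1])
  obtain ⟨kstar, hkstar⟩ := exists_eq_ciSup_of_finite (f := w)
  change (⨆ k, w k) - w rhat ≤ _
  rw [← hkstar]
  rcases le_or_gt (w kstar) (w rhat) with hle | hlt
  · exact (sub_nonpos.2 hle).trans (mul_nonneg zero_le_two (Real.sqrt_nonneg _))
  have hZ : ∀ r : Fin m → ℝ, 0 < ∑ k', Real.exp (r k') := fun r =>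
    Finset.sum_pos (fun k _ => Real.exp_pos _) Finset.univ_nonempty
  set S : Fin m → ℝ := fun k => Real.exp (r k) / ∑ k', Real.exp (r k') with hSdef
  have hS : ∀ k, 0 < S k := fun k => div_pos (Real.exp_pos _) (hZ r)
  have hSsum : ∑ k, S k = 1 := by
    rw [hSdef, ← Finset.sum_div, div_self (hZ r).ne']
  have hSmax : ∀ k, S k ≤ S rhat := fun k =>
    div_le_div_of_nonneg_right (Real.exp_le_exp.2 (hrhat k)) (hZ r).le
  have hbdd : BddBelow (Set.range fun r' : Fin m → ℝ => (1 / q) * ∑ k, w k *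
      (1 - (Real.exp (r' k) / ∑ k', Real.exp (r' k')) ^ q)) := by
    refine ⟨0, ?_⟩
    rintro _ ⟨r', rfl⟩
    refine mul_nonneg (one_div_pos.2 hq0).le (Finset.sum_nonneg fun k _ =>
      mul_nonneg (hw0 k) (sub_nonneg.2 (Real.rpow_le_one (div_nonneg (Real.exp_pos _).le
        (hZ r').le) (div_le_one_of_le₀ ?_ (hZ r').le) hq0.le)))
    exact Finset.single_le_sum (f := fun k => Real.exp (r' k))
      (fun k _ => (Real.exp_pos _).le) (Finset.mem_univ k)
  have hgain : ∀ T : Fin m → ℝ, (∀ k, 0 < T k) → ∑ k, T k = 1 →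
      1 / q * ∑ k, w k * (1 - S k ^ q) - 1 / q * ∑ k, w k * (1 - T k ^ q) ≤ Δ := by
    intro T hT hTsum
    rw [hΔ]
    refine sub_le_sub_left ((ciInf_le hbdd fun k => Real.log (T k)).trans_eq ?_) _
    simp only [exp_log_div_sum_exp_log hT hTsum]
  have hne : kstar ≠ rhat := fun h => hlt.ne' (by rw [h])
  have hsum_pos : 0 < w kstar + w rhat := by linarith [hw0 rhat]
  have hpair := gce_pair_gain_le hq0 hS hSsum hne hgain
    (x := (w kstar - w rhat) / (w kstar + w rhat))
    ⟨by rw [le_div_iff₀ hsum_pos]; linarith, by rw [div_le_iff₀ hsum_pos]; linarith [hw0 rhat]⟩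
  have hsplit := quadratic_margin_of_proportional_split hq (hw0 rhat) hlt (hw1 kstar)
    (σ := S rhat + S kstar) (by linarith [hS rhat, hS kstar])
  have heven := mul_rpow_add_mul_rpow_le hq (hw0 rhat) hlt.le (hS kstar) (hSmax kstar)
  have hΔq : (S rhat + S kstar) ^ q * ((w kstar - w rhat) / 2) ^ 2 ≤ Δ := by
    refine le_of_mul_le_mul_left ?_ hq0
    linarith
  have hm0 : (0 : ℝ) < m := by exact_mod_cast (by omega : 0 < m)
  have hmass : 1 ≤ (m : ℝ) * (S rhat + S kstar) := by
    have : ∑ k, S k ≤ (m : ℝ) * S rhat := by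
      simpa using Finset.sum_le_card_nsmul Finset.univ S (S rhat) fun k _ => hSmax k
    nlinarith [hS kstar]
  have hmq : 1 ≤ (m : ℝ) ^ q * (S rhat + S kstar) ^ q := by
    rw [← Real.mul_rpow hm0.le (by linarith [hS rhat, hS kstar])]
    exact Real.one_le_rpow hmass hq0.le
  have hfinal : ((w kstar - w rhat) / 2) ^ 2 ≤ (m : ℝ) ^ q * Δ :=
    calc _ ≤ (m : ℝ) ^ q * (S rhat + S kstar) ^ q * ((w kstar - w rhat) / 2) ^ 2 :=
          le_mul_of_one_le_left (sq_nonneg _) hmq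
      _ = (m : ℝ) ^ q * ((S rhat + S kstar) ^ q * ((w kstar - w rhat) / 2) ^ 2) := by ring
      _ ≤ _ := mul_le_mul_of_nonneg_left hΔq (Real.rpow_nonneg hm0.le q)
  linarith [Real.le_sqrt_of_sq_le hfinal]
end

section
/- Let n ≥ 1 and m ≥ 2. Let p be a probability vector on Fin n, c : Fin m → Fin n → ℝ a cost function with 0 ≤ c k y ≤ 1 for all k, y, and set q̄(k) = ∑_y p y · (1 − c k y). Let r : Fin m → ℝ be a score vector and r̂ ∈ Fin m any index at which r attains its maximum. Let Δ = C(r) − inf { C(r') : r' : Fin m → ℝ }, where C(r') = ∑_k q̄(k)·(1 − S_{r'}(k)) and S_{r'}(k) = exp(r' k)/∑_{k'} exp(r' k'). Then (max_k q̄(k)) − q̄(r̂) ≤ m·Δ. -/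
open Filter Topology in
/-- The infimum over scores of the softmax mean absolute error is at most its value at a point
mass. -/
theorem iInf_sum_mul_one_sub_softmax_le {ι : Type*} [Fintype ι] (q : ι → ℝ)
    (hq : ∀ k, 0 ≤ q k) (j : ι) :
    ⨅ r : ι → ℝ, ∑ k, q k * (1 - Real.exp (r k) / ∑ k', Real.exp (r k')) ≤
      ∑ k, q k - q j := by
  classical
  have hS0 (r : ι → ℝ) (k : ι) : 0 ≤ Real.exp (r k) / ∑ k', Real.exp (r k') := by positivity
  have hS1 (r : ι → ℝ) (k : ι) : Real.exp (r k) / ∑ k', Real.exp (r k') ≤ 1 :=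
    div_le_one_of_le₀ (Finset.single_le_sum (f := fun k' => Real.exp (r k'))
      (fun _ _ => (Real.exp_pos _).le) (Finset.mem_univ k)) (by positivity)
  have hbdd : BddBelow (Set.range fun r : ι → ℝ =>
      ∑ k, q k * (1 - Real.exp (r k) / ∑ k', Real.exp (r k'))) := by
    refine ⟨0, ?_⟩
    rintro _ ⟨r, rfl⟩
    exact Finset.sum_nonneg fun k _ => mul_nonneg (hq k) (sub_nonneg.2 (hS1 r k))
  let s : ℝ → ι → ℝ := fun t k => if k = j then 0 else -t
  have hle (t : ℝ) : ⨅ r : ι → ℝ, ∑ k, q k * (1 - Real.exp (r k) / ∑ k', Real.exp (r k')) ≤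
      ∑ k, q k - q j * (1 / ∑ k', Real.exp (s t k')) := by
    refine (ciInf_le hbdd (s t)).trans ?_
    have h := Finset.single_le_sum
      (f := fun k => q k * (Real.exp (s t k) / ∑ k', Real.exp (s t k')))
      (fun k _ => mul_nonneg (hq k) (hS0 (s t) k)) (Finset.mem_univ j)
    have hj : Real.exp (s t j) = 1 := by simp [s]
    simp only [hj] at h
    simp only [mul_sub, mul_one, Finset.sum_sub_distrib]
    linarith
  have hsum : Tendsto (fun t => ∑ k', Real.exp (s t k')) atTop (𝓝 1) := by
    have : Tendsto (fun t => ∑ k', Real.exp (s t k')) atTop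
        (𝓝 (∑ k', if k' = j then (1 : ℝ) else 0)) := by
      refine tendsto_finsetSum _ fun k _ => ?_
      by_cases hk : k = j
      · simp [s, hk]
      · simpa [s, hk] using Real.tendsto_exp_neg_atTop_nhds_zero
    simpa using this
  have hlim : Tendsto (fun t => ∑ k, q k - q j * (1 / ∑ k', Real.exp (s t k'))) atTop
      (𝓝 (∑ k, q k - q j * (1 / 1))) :=
    ((tendsto_const_nhds.div hsum one_ne_zero).const_mul _).const_sub _
  simpa using ge_of_tendsto' hlim hle

/-- The softmax weight of a maximal score is at least the uniform weight. -/
theorem one_le_card_mul_softmax {ι : Type*} [Fintype ι] (r : ι → ℝ) (i : ι)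
    (hi : ∀ k, r k ≤ r i) :
    1 ≤ (Fintype.card ι : ℝ) * (Real.exp (r i) / ∑ k, Real.exp (r k)) := by
  have hpos : 0 < ∑ k, Real.exp (r k) :=
    Finset.sum_pos (fun _ _ => Real.exp_pos _) ⟨i, Finset.mem_univ i⟩
  rw [← mul_div_assoc, one_le_div hpos]
  simpa using Finset.sum_le_card_nsmul Finset.univ (fun k => Real.exp (r k)) (Real.exp (r i))
    fun k _ => Real.exp_le_exp.2 (hi k)

/-- Pointwise form of the paper's Theorem 2 for the cost-sensitive mean absolute error loss:
the conditional regret of the cardinality-aware target loss is at most `m Δ`, where `Δ` is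
the conditional regret of the cost-sensitive mean absolute error loss. -/
theorem cardinality_aware_consistency_cost_mae
    (n m : ℕ) (hn : 1 ≤ n) (hm : 2 ≤ m)
    (p : Fin n → ℝ) (hp : ∀ y, 0 ≤ p y) (hpsum : ∑ y, p y = 1)
    (c : Fin m → Fin n → ℝ) (hc : ∀ k y, 0 ≤ c k y ∧ c k y ≤ 1)
    (r : Fin m → ℝ) (rhat : Fin m) (hrhat : ∀ k, r k ≤ r rhat)
    (Δ : ℝ)
    (hΔ : Δ = (∑ k, (∑ y, p y * (1 - c k y)) *
            (1 - Real.exp (r k) / ∑ k', Real.exp (r k')))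
        - ⨅ r' : Fin m → ℝ, ∑ k, (∑ y, p y * (1 - c k y)) *
            (1 - Real.exp (r' k) / ∑ k', Real.exp (r' k'))) :
    (⨆ k : Fin m, ∑ y, p y * (1 - c k y)) - (∑ y, p y * (1 - c rhat y))
      ≤ (m : ℝ) * Δ := by
  have : Nonempty (Fin m) := ⟨rhat⟩
  have hq (k : Fin m) : 0 ≤ ∑ y, p y * (1 - c k y) :=
    Finset.sum_nonneg fun y _ => mul_nonneg (hp y) (sub_nonneg.2 (hc k y).2)
  set q : Fin m → ℝ := fun k => ∑ y, p y * (1 - c k y)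
  change ∀ k, 0 ≤ q k at hq
  change (⨆ k, q k) - q rhat ≤ m * Δ
  change Δ = ∑ k, q k * (1 - Real.exp (r k) / ∑ k', Real.exp (r k')) -
    ⨅ r' : Fin m → ℝ, ∑ k, q k * (1 - Real.exp (r' k) / ∑ k', Real.exp (r' k')) at hΔ
  clear_value q
  obtain ⟨j, hj⟩ := exists_eq_ciSup_of_finite (f := q)
  have hmax (k : Fin m) : q k ≤ q j := hj ▸ le_ciSup (Set.finite_range q).bddAbove k
  have hinf := iInf_sum_mul_one_sub_softmax_le q hq j
  have hS := one_le_card_mul_softmax r rhat hrhat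
  rw [Fintype.card_fin] at hS
  have hpos : 0 < ∑ k, Real.exp (r k) :=
    Finset.sum_pos (fun _ _ => Real.exp_pos _) ⟨rhat, Finset.mem_univ _⟩
  have hsum : ∑ k, Real.exp (r k) / ∑ k', Real.exp (r k') = 1 := by
    rw [← Finset.sum_div, div_self hpos.ne']
  have hone := Finset.single_le_sum
    (f := fun k => (q j - q k) * (Real.exp (r k) / ∑ k', Real.exp (r k')))
    (fun k _ => mul_nonneg (sub_nonneg.2 (hmax k)) (by positivity)) (Finset.mem_univ rhat)
  simp only [sub_mul, Finset.sum_sub_distrib, ← Finset.mul_sum, hsum] at hone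
  have hreg : (q j - q rhat) * (Real.exp (r rhat) / ∑ k', Real.exp (r k')) ≤ Δ := by
    rw [hΔ]
    simp only [mul_sub, mul_one, Finset.sum_sub_distrib] at hinf ⊢
    linarith
  rw [← hj]
  calc q j - q rhat
      ≤ (q j - q rhat) * (m * (Real.exp (r rhat) / ∑ k', Real.exp (r k'))) :=
        le_mul_of_one_le_right (sub_nonneg.2 (hmax rhat)) hS
    _ = m * ((q j - q rhat) * (Real.exp (r rhat) / ∑ k', Real.exp (r k'))) := by ring
    _ ≤ m * Δ := mul_le_mul_of_nonneg_left hreg (Nat.cast_nonneg m)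
end

section
/- Let n ≥ 1 and m ≥ 2. Let p be a probability vector on Fin n, c : Fin m → Fin n → ℝ a cost function with 0 ≤ c k y ≤ 1 for all k, y, and set q̃(k) = ∑_y p y · c k y. Let r : Fin m → ℝ satisfy ∑_k r k = 0 and let r̂ ∈ Fin m be any index at which r attains its maximum. Let Δ = C(r) − inf { C(r') : r' : Fin m → ℝ, ∑_k r' k = 0 }, where C(r') = ∑_k q̃(k)·exp(r' k). Then q̃(r̂) − (min_k q̃(k)) ≤ 2·√Δ. -/
open Finset in
/-- Moving `log t` from coordinate `j` to coordinate `i` of a score vector keeps the sum of the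
scores and changes the weighted exponential sum only through the coordinates `i` and `j`. -/
lemma exists_transfer_weighted_exp {ι : Type*} [Fintype ι] (q r : ι → ℝ) {i j : ι} (hij : i ≠ j)
    {t : ℝ} (ht : 0 < t) :
    ∃ r' : ι → ℝ, ∑ k, r' k = ∑ k, r k ∧
      ∑ k, q k * Real.exp (r' k) = ∑ k, q k * Real.exp (r k)
        + q i * Real.exp (r i) * (t - 1) + q j * Real.exp (r j) * (t⁻¹ - 1) := by
  classical
  refine ⟨fun k => r k + (if k = i then Real.log t else 0) - (if k = j then Real.log t else 0),
    by simp [sum_add_distrib], ?_⟩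
  have key : ∀ k, q k * Real.exp
      (r k + (if k = i then Real.log t else 0) - (if k = j then Real.log t else 0))
      = q k * Real.exp (r k) + (if k = i then q i * Real.exp (r i) * (t - 1) else 0)
        + (if k = j then q j * Real.exp (r j) * (t⁻¹ - 1) else 0) := by
    intro k
    by_cases hi : k = i
    · subst hi
      simp [hij, Real.exp_add, Real.exp_log ht]
      ring
    · by_cases hj : k = j
      · subst hj
        simp [hi, Real.exp_sub, Real.exp_log ht]
        ring
      · simp [hi, hj]
  simp [key, sum_add_distrib]

/-- For weights in `[0, 1]`, the squared gap between the weight at a maximal score and any smaller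
weight is controlled by the excess of the weighted exponential sum over zero-sum scores. -/
lemma weight_gap_le_two_mul_sqrt {ι : Type*} [Fintype ι] (q : ι → ℝ) (hq0 : ∀ k, 0 ≤ q k)
    (hq1 : ∀ k, q k ≤ 1) (r : ι → ℝ) (hr : ∑ k, r k = 0) (i : ι) (hi : ∀ k, r k ≤ r i) (j : ι) :
    q i - q j ≤ 2 * Real.sqrt ((∑ k, q k * Real.exp (r k))
      - sInf {x : ℝ | ∃ r' : ι → ℝ, (∑ k, r' k = 0) ∧ x = ∑ k, q k * Real.exp (r' k)}) := by
  rcases le_or_gt (q i) (q j) with hle | hlt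
  · exact (sub_nonpos.2 hle).trans (by positivity)
  have hij : i ≠ j := by
    rintro rfl
    exact lt_irrefl _ hlt
  have hb := hq0 j
  have ha : 0 < q i := hb.trans_lt hlt
  have hri : 0 ≤ r i := by
    by_contra! hneg
    have : ∑ k, r k < 0 :=
      Finset.sum_neg (fun k _ => (hi k).trans_lt hneg) ⟨i, Finset.mem_univ i⟩
    exact this.ne hr
  have ht : 0 < (q i + q j) / (2 * q i) := by positivity
  obtain ⟨r', hr'0, hr'⟩ := exists_transfer_weighted_exp q r hij ht
  have hinf := csInf_le (s := {x : ℝ | ∃ r' : ι → ℝ, (∑ k, r' k = 0) ∧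
      x = ∑ k, q k * Real.exp (r' k)})
    ⟨0, by
      rintro x ⟨r', -, rfl⟩
      exact Finset.sum_nonneg fun k _ => mul_nonneg (hq0 k) (Real.exp_pos _).le⟩
    ⟨r', hr'0.trans hr, rfl⟩
  rw [hr'] at hinf
  have hexp : Real.exp (r j) ≤ Real.exp (r i) := Real.exp_le_exp.2 (hi j)
  have hone : 1 ≤ Real.exp (r i) := Real.one_le_exp hri
  have e1 : q i * Real.exp (r i) * ((q i + q j) / (2 * q i) - 1)
      = - (Real.exp (r i) * ((q i - q j) / 2)) := by
    field_simp
    ring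
  have e2 : q j * Real.exp (r j) * (((q i + q j) / (2 * q i))⁻¹ - 1)
      = Real.exp (r j) * (q j * (q i - q j) / (q i + q j)) := by
    field_simp
    ring
  have e3 : Real.exp (r j) * (q j * (q i - q j) / (q i + q j))
      ≤ Real.exp (r i) * (q j * (q i - q j) / (q i + q j)) :=
    mul_le_mul_of_nonneg_right hexp
      (div_nonneg (mul_nonneg hb (sub_nonneg.2 hlt.le)) (by positivity))
  have e4 : (q i - q j) / 2 - q j * (q i - q j) / (q i + q j)
      = (q i - q j) ^ 2 / (2 * (q i + q j)) := by
    field_simp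
    ring
  have e5 : (q i - q j) ^ 2 / 4 ≤ (q i - q j) ^ 2 / (2 * (q i + q j)) := by
    gcongr
    linarith [hq1 i, hq1 j]
  have e6 : (q i - q j) ^ 2 / (2 * (q i + q j))
      ≤ Real.exp (r i) * ((q i - q j) ^ 2 / (2 * (q i + q j))) :=
    le_mul_of_one_le_left (by positivity) hone
  rw [← e4] at e5 e6
  rw [mul_sub (Real.exp (r i))] at e6
  rw [e1, e2] at hinf
  have hsqrt : (q i - q j) / 2 ≤ Real.sqrt ((∑ k, q k * Real.exp (r k))
      - sInf {x : ℝ | ∃ r' : ι → ℝ, (∑ k, r' k = 0) ∧ x = ∑ k, q k * Real.exp (r' k)}) :=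
    Real.le_sqrt_of_sq_le (by rw [div_pow]; linarith)
  linarith


/-- Pointwise form of the paper's Theorem 3 for the cost-sensitive constrained exponential
loss: the conditional regret of the cardinality-aware target loss is at most `2 √Δ`, where
`Δ` is the conditional regret of the cost-sensitive constrained exponential loss. -/
theorem cardinality_aware_consistency_cost_constrained_exp
    (n m : ℕ) (hn : 1 ≤ n) (hm : 2 ≤ m)
    (p : Fin n → ℝ) (hp : ∀ y, 0 ≤ p y) (hpsum : ∑ y, p y = 1)
    (c : Fin m → Fin n → ℝ) (hc : ∀ k y, 0 ≤ c k y ∧ c k y ≤ 1)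
    (r : Fin m → ℝ) (hr : ∑ k, r k = 0)
    (rhat : Fin m) (hrhat : ∀ k, r k ≤ r rhat)
    (Δ : ℝ)
    (hΔ : Δ = (∑ k, (∑ y, p y * c k y) * Real.exp (r k))
        - sInf {x : ℝ | ∃ r' : Fin m → ℝ, (∑ k, r' k = 0) ∧
            x = ∑ k, (∑ y, p y * c k y) * Real.exp (r' k)}) :
    (∑ y, p y * c rhat y) - (⨅ k : Fin m, ∑ y, p y * c k y)
      ≤ 2 * Real.sqrt Δ := by
  have : Nonempty (Fin m) := ⟨rhat⟩
  obtain ⟨j, hj⟩ := exists_eq_ciInf_of_finite (f := fun k : Fin m => ∑ y, p y * c k y)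
  rw [← hj, hΔ]
  refine weight_gap_le_two_mul_sqrt (fun k => ∑ y, p y * c k y)
    (fun k => Finset.sum_nonneg fun y _ => mul_nonneg (hp y) (hc k y).1)
    (fun k => ?_) r hr rhat hrhat j
  calc ∑ y, p y * c k y ≤ ∑ y, p y :=
        Finset.sum_le_sum fun y _ => mul_le_of_le_one_right (hp y) (hc k y).2
    _ = 1 := hpsum
end

section
/- Let n ≥ 1 and m ≥ 2. Let p be a probability vector on Fin n, c : Fin m → Fin n → ℝ a cost function with 0 ≤ c k y ≤ 1 for all k, y, and set q̃(k) = ∑_y p y · c k y. Let r : Fin m → ℝ satisfy ∑_k r k = 0 and let r̂ ∈ Fin m be any index at which r attains its maximum. Let Δ = C(r) − inf { C(r') : r' : Fin m → ℝ, ∑_k r' k = 0 }, where C(r') = ∑_k q̃(k)·(max(0, 1 + r' k))². Then q̃(r̂) − (min_k q̃(k)) ≤ 2·√Δ. -/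
/-- Moving the optimal mass from the coordinate `X` to the coordinate `Y` lowers a weighted
two-term squared hinge by at least `(a - b) ^ 2 / 2`. -/
lemma exists_transfer_sq_hinge_le {a b X Y : ℝ} (hb : 0 ≤ b) (hab : b < a) (ha : a ≤ 1)
    (hX : 1 ≤ X) (hYX : Y ≤ X) :
    ∃ t : ℝ, a * (max 0 (X - t)) ^ 2 + b * (max 0 (Y + t)) ^ 2 + (a - b) ^ 2 / 2
      ≤ a * (max 0 X) ^ 2 + b * (max 0 Y) ^ 2 := by
  set Z := max 0 Y with hZ
  have hZ0 : 0 ≤ Z := le_max_left _ _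
  have hYZ : Y ≤ Z := le_max_right _ _
  have hZX : Z ≤ X := max_le (by linarith) hYX
  have hs : 0 < a + b := by linarith
  have ha0 : 0 ≤ a := by linarith
  refine ⟨(a * X - b * Z) / (a + b), ?_⟩
  have hX' : X - (a * X - b * Z) / (a + b) = b * (X + Z) / (a + b) := by
    field_simp
    ring
  have hZ' : Z + (a * X - b * Z) / (a + b) = a * (X + Z) / (a + b) := by
    field_simp
    ring
  have hX'0 : 0 ≤ b * (X + Z) / (a + b) := by positivity
  have hZ'0 : 0 ≤ a * (X + Z) / (a + b) := by positivity
  have hY' : max 0 (Y + (a * X - b * Z) / (a + b)) ≤ a * (X + Z) / (a + b) :=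
    max_le hZ'0 (by linarith)
  have hsq : (max 0 (Y + (a * X - b * Z) / (a + b))) ^ 2 ≤ (a * (X + Z) / (a + b)) ^ 2 :=
    pow_le_pow_left₀ (le_max_left _ _) hY' 2
  rw [hX', max_eq_right hX'0, max_eq_right (by linarith : (0 : ℝ) ≤ X)]
  have hid : a * X ^ 2 + b * Z ^ 2
      - (a * (b * (X + Z) / (a + b)) ^ 2 + b * (a * (X + Z) / (a + b)) ^ 2)
      = (a * X - b * Z) ^ 2 / (a + b) := by
    field_simp
    ring
  have hlow : a - b ≤ a * X - b * Z := by nlinarith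
  have hfrac : (a - b) ^ 2 / 2 ≤ (a * X - b * Z) ^ 2 / (a + b) :=
    div_le_div₀ (sq_nonneg _) (pow_le_pow_left₀ (by linarith) hlow 2) hs (by linarith)
  have := mul_le_mul_of_nonneg_left hsq hb
  linarith

/-- Changing the score vector at two distinct indices only changes the two corresponding terms
of the weighted squared hinge. -/
lemma sum_sq_hinge_transfer {ι : Type*} [Fintype ι] [DecidableEq ι] (q r : ι → ℝ) {i j : ι}
    (hij : i ≠ j) (t : ℝ) :
    ∑ k, q k * (max 0 (1 + (r k + ((if k = j then t else 0) - if k = i then t else 0)))) ^ 2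
      = ∑ k, q k * (max 0 (1 + r k)) ^ 2
        + (q j * (max 0 (1 + r j + t)) ^ 2 - q j * (max 0 (1 + r j)) ^ 2)
        + (q i * (max 0 (1 + r i - t)) ^ 2 - q i * (max 0 (1 + r i)) ^ 2) := by
  have hterm : ∀ k,
      q k * (max 0 (1 + (r k + ((if k = j then t else 0) - if k = i then t else 0)))) ^ 2
      = q k * (max 0 (1 + r k)) ^ 2
        + (if k = j then q j * (max 0 (1 + r j + t)) ^ 2 - q j * (max 0 (1 + r j)) ^ 2 else 0)
        + (if k = i then q i * (max 0 (1 + r i - t)) ^ 2 - q i * (max 0 (1 + r i)) ^ 2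
          else 0) := by
    intro k
    by_cases hj : k = j
    · subst hj
      simp [hij.symm, add_assoc]
    · by_cases hi : k = i
      · subst hi
        simp [hij, sub_eq_add_neg, add_assoc]
      · simp [hi, hj]
  rw [Finset.sum_congr rfl fun k _ => hterm k]
  simp [Finset.sum_add_distrib]


/-- Pointwise form of the paper's Theorem 3 for the cost-sensitive constrained squared hinge
loss: the conditional regret of the cardinality-aware target loss is at most `2 √Δ`, where
`Δ` is the conditional regret of the cost-sensitive constrained squared hinge loss. -/
theorem cardinality_aware_consistency_cost_constrained_sq_hinge
    (n m : ℕ) (hn : 1 ≤ n) (hm : 2 ≤ m)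
    (p : Fin n → ℝ) (hp : ∀ y, 0 ≤ p y) (hpsum : ∑ y, p y = 1)
    (c : Fin m → Fin n → ℝ) (hc : ∀ k y, 0 ≤ c k y ∧ c k y ≤ 1)
    (r : Fin m → ℝ) (hr : ∑ k, r k = 0)
    (rhat : Fin m) (hrhat : ∀ k, r k ≤ r rhat)
    (Δ : ℝ)
    (hΔ : Δ = (∑ k, (∑ y, p y * c k y) * (max 0 (1 + r k)) ^ 2)
        - sInf {x : ℝ | ∃ r' : Fin m → ℝ, (∑ k, r' k = 0) ∧
            x = ∑ k, (∑ y, p y * c k y) * (max 0 (1 + r' k)) ^ 2}) :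
    (∑ y, p y * c rhat y) - (⨅ k : Fin m, ∑ y, p y * c k y)
      ≤ 2 * Real.sqrt Δ := by
  have hm0 : Nonempty (Fin m) := ⟨rhat⟩
  set q : Fin m → ℝ := fun k => ∑ y, p y * c k y with hq
  have hq0 : ∀ k, 0 ≤ q k := fun k =>
    Finset.sum_nonneg fun y _ => mul_nonneg (hp y) (hc k y).1
  have hq1 : ∀ k, q k ≤ 1 := fun k => by
    rw [← hpsum]
    exact Finset.sum_le_sum fun y _ => mul_le_of_le_one_right (hp y) (hc k y).2
  obtain ⟨j, hj⟩ := exists_eq_ciInf_of_finite (f := q)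
  change q rhat - (⨅ k, q k) ≤ _
  rw [← hj]
  rcases le_or_gt (q rhat) (q j) with hle | hlt
  · have := Real.sqrt_nonneg Δ
    linarith
  have hij : rhat ≠ j := by
    rintro rfl
    exact lt_irrefl _ hlt
  have hr0 : 0 ≤ r rhat := by
    by_contra! hneg
    have : ∑ k, r k < 0 :=
      Finset.sum_neg (fun k _ => (hrhat k).trans_lt hneg) Finset.univ_nonempty
    linarith
  obtain ⟨t, ht⟩ := exists_transfer_sq_hinge_le (X := 1 + r rhat) (Y := 1 + r j)
    (hq0 j) hlt (hq1 rhat) (by linarith) (by linarith [hrhat j])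
  have hbdd : BddBelow {x : ℝ | ∃ r' : Fin m → ℝ, (∑ k, r' k = 0) ∧
      x = ∑ k, q k * (max 0 (1 + r' k)) ^ 2} := by
    refine ⟨0, ?_⟩
    rintro x ⟨r', -, rfl⟩
    exact Finset.sum_nonneg fun k _ => mul_nonneg (hq0 k) (sq_nonneg _)
  have hinf := csInf_le hbdd
    ⟨fun k => r k + ((if k = j then t else 0) - if k = rhat then t else 0),
      by simp [Finset.sum_add_distrib, hr], rfl⟩
  rw [sum_sq_hinge_transfer q r hij t] at hinf
  have hΔ' : (q rhat - q j) ^ 2 / 2 ≤ Δ := by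
    rw [hΔ]
    linarith
  have hhalf : (q rhat - q j) / 2 ≤ √Δ := by
    apply Real.le_sqrt_of_sq_le
    nlinarith [sq_nonneg (q rhat - q j)]
  linarith
end

section
/- Let n ≥ 1 and m ≥ 2. Let p be a probability vector on Fin n, c : Fin m → Fin n → ℝ a cost function with 0 ≤ c k y ≤ 1 for all k, y, and set q̃(k) = ∑_y p y · c k y. Let r : Fin m → ℝ satisfy ∑_k r k = 0 and let r̂ ∈ Fin m be any index at which r attains its maximum. Let Δ = C(r) − inf { C(r') : r' : Fin m → ℝ, ∑_k r' k = 0 }, where C(r') = ∑_k q̃(k)·max(0, 1 + r' k). Then q̃(r̂) − (min_k q̃(k)) ≤ Δ. -/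
/-- If the scores sum to zero and `i` is a maximal score, the hinge-weighted cost exceeds
`card ι • q j` by at least `q i - q j`, for every index `j` of minimal (nonnegative) cost. -/
theorem sub_le_sum_mul_hinge_sub {ι : Type*} [Fintype ι] (q r : ι → ℝ) (i j : ι)
    (hj : 0 ≤ q j) (hmin : ∀ k, q j ≤ q k) (hr : ∑ k, r k = 0) (hmax : ∀ k, r k ≤ r i) :
    q i - q j ≤ ∑ k, q k * max 0 (1 + r k) - Fintype.card ι * q j := by
  have hri : 0 ≤ r i := by
    by_contra! h
    have : ∑ k, r k < 0 :=
      Finset.sum_neg (fun k _ => (hmax k).trans_lt h) ⟨i, Finset.mem_univ i⟩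
    linarith
  have hcard : (Fintype.card ι : ℝ) ≤ ∑ k, max 0 (1 + r k) := by
    calc (Fintype.card ι : ℝ) = ∑ k, (1 + r k) := by simp [Finset.sum_add_distrib, hr]
      _ ≤ _ := Finset.sum_le_sum fun k _ => le_max_right _ _
  have hterm : (q i - q j) * max 0 (1 + r i) ≤ ∑ k, (q k - q j) * max 0 (1 + r k) :=
    Finset.single_le_sum (f := fun k => (q k - q j) * max 0 (1 + r k))
      (fun k _ => mul_nonneg (sub_nonneg.2 (hmin k)) (le_max_left _ _)) (Finset.mem_univ i)
  have hone : q i - q j ≤ (q i - q j) * max 0 (1 + r i) :=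
    le_mul_of_one_le_right (sub_nonneg.2 (hmin i)) (le_max_of_le_right (by linarith))
  have hsplit : ∑ k, (q k - q j) * max 0 (1 + r k)
      = ∑ k, q k * max 0 (1 + r k) - q j * ∑ k, max 0 (1 + r k) := by
    simp only [sub_mul, Finset.sum_sub_distrib, Finset.mul_sum]
  linarith [mul_le_mul_of_nonneg_left hcard hj]

/-- Putting all the score mass on `j` shows that the infimal constrained hinge cost is at most
`card ι • q j`. -/
theorem sInf_sum_mul_hinge_le {ι : Type*} [Fintype ι] (q : ι → ℝ) (hq : ∀ k, 0 ≤ q k) (j : ι) :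
    sInf {x : ℝ | ∃ r : ι → ℝ, (∑ k, r k = 0) ∧ x = ∑ k, q k * max 0 (1 + r k)}
      ≤ Fintype.card ι * q j := by
  classical
  refine csInf_le ⟨0, ?_⟩ ⟨fun k => (if k = j then (Fintype.card ι : ℝ) else 0) - 1, ?_, ?_⟩
  · rintro _ ⟨r, -, rfl⟩
    exact Finset.sum_nonneg fun k _ => mul_nonneg (hq k) (le_max_left _ _)
  · simp [Finset.sum_sub_distrib]
  · rw [Finset.sum_eq_single j (fun k _ hk => by simp [hk]) (by simp)]
    simp [mul_comm]

/-- Pointwise form of the paper's Theorem 3 for the cost-sensitive constrained hinge loss: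
the conditional regret of the cardinality-aware target loss is at most `Δ`, the conditional
regret of the cost-sensitive constrained hinge loss. -/
theorem cardinality_aware_consistency_cost_constrained_hinge
    (n m : ℕ) (hn : 1 ≤ n) (hm : 2 ≤ m)
    (p : Fin n → ℝ) (hp : ∀ y, 0 ≤ p y) (hpsum : ∑ y, p y = 1)
    (c : Fin m → Fin n → ℝ) (hc : ∀ k y, 0 ≤ c k y ∧ c k y ≤ 1)
    (r : Fin m → ℝ) (hr : ∑ k, r k = 0)
    (rhat : Fin m) (hrhat : ∀ k, r k ≤ r rhat)
    (Δ : ℝ)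
    (hΔ : Δ = (∑ k, (∑ y, p y * c k y) * max 0 (1 + r k))
        - sInf {x : ℝ | ∃ r' : Fin m → ℝ, (∑ k, r' k = 0) ∧
            x = ∑ k, (∑ y, p y * c k y) * max 0 (1 + r' k)}) :
    (∑ y, p y * c rhat y) - (⨅ k : Fin m, ∑ y, p y * c k y) ≤ Δ := by
  have : Nonempty (Fin m) := ⟨rhat⟩
  have hq : ∀ k, 0 ≤ ∑ y, p y * c k y := fun k =>
    Finset.sum_nonneg fun y _ => mul_nonneg (hp y) (hc k y).1
  obtain ⟨j, hj⟩ := exists_eq_ciInf_of_finite (f := fun k => ∑ y, p y * c k y)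
  have hmin : ∀ k, ∑ y, p y * c j y ≤ ∑ y, p y * c k y := fun k =>
    hj.le.trans (ciInf_le (Set.finite_range _).bddBelow k)
  have hlower := sub_le_sum_mul_hinge_sub (fun k => ∑ y, p y * c k y) r rhat j
    (hq j) hmin hr hrhat
  have hupper := sInf_sum_mul_hinge_le (fun k => ∑ y, p y * c k y) hq j
  rw [hΔ, ← hj]
  linarith
end

section
/- Let n ≥ 1, m ≥ 2, and ρ > 0. Let p be a probability vector on Fin n, c : Fin m → Fin n → ℝ a cost function with 0 ≤ c k y ≤ 1 for all k, y, and set q̃(k) = ∑_y p y · c k y. Let r : Fin m → ℝ satisfy ∑_k r k = 0 and let r̂ ∈ Fin m be any index at which r attains its maximum. Let Δ = C(r) − inf { C(r') : r' : Fin m → ℝ, ∑_k r' k = 0 }, where C(r') = ∑_k q̃(k)·min(max(0, 1 + r' k/ρ), 1). Then q̃(r̂) − (min_k q̃(k)) ≤ Δ. -/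
/-- For nonnegative weights `q`, at a zero-sum score vector the `ρ`-margin conditional error
is at least the weight of any index with a maximal score. -/
lemma le_sum_mul_clamp_of_isMax {ι : Type*} [Fintype ι] {q : ι → ℝ} (hq : ∀ k, 0 ≤ q k)
    {ρ : ℝ} (hρ : 0 < ρ) {r : ι → ℝ} (hr : ∑ k, r k = 0) {i : ι} (hi : ∀ k, r k ≤ r i) :
    q i ≤ ∑ k, q k * min (max 0 (1 + r k / ρ)) 1 := by
  have hri : 0 ≤ r i := by
    by_contra! h
    have : ∑ k, r k < ∑ _k : ι, (0 : ℝ) :=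
      Finset.sum_lt_sum_of_nonempty ⟨i, Finset.mem_univ i⟩ fun k _ => (hi k).trans_lt h
    simp [hr] at this
  have hclamp : min (max 0 (1 + r i / ρ)) 1 = 1 :=
    min_eq_right (le_max_of_le_right (by linarith [div_nonneg hri hρ.le]))
  calc q i = q i * min (max 0 (1 + r i / ρ)) 1 := by rw [hclamp, mul_one]
    _ ≤ _ := Finset.single_le_sum (f := fun k => q k * min (max 0 (1 + r k / ρ)) 1)
      (fun k _ => mul_nonneg (hq k) (le_min (le_max_left _ _) zero_le_one)) (Finset.mem_univ i)

/-- Every weight is attained as a `ρ`-margin conditional error at a zero-sum score vector. -/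
lemma exists_sum_eq_zero_sum_mul_clamp_eq {ι : Type*} [Fintype ι] (q : ι → ℝ)
    {ρ : ℝ} (hρ : 0 < ρ) (i : ι) :
    ∃ r : ι → ℝ, ∑ k, r k = 0 ∧ ∑ k, q k * min (max 0 (1 + r k / ρ)) 1 = q i := by
  classical
  refine ⟨fun k => (if k = i then Fintype.card ι * ρ else 0) - ρ, by simp, ?_⟩
  have hcard : (1 : ℝ) ≤ Fintype.card ι := by
    exact_mod_cast Fintype.card_pos_iff.mpr ⟨i⟩
  rw [Finset.sum_eq_single i]
  · have h : 1 + (Fintype.card ι * ρ - ρ) / ρ = Fintype.card ι := by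
      field_simp
      ring
    beta_reduce
    rw [if_pos rfl, h, min_eq_right (le_max_of_le_right hcard), mul_one]
  · intro k _ hk
    simp [hk, hρ.ne']
  · simp


/-- Pointwise form of the paper's Theorem 3 for the cost-sensitive constrained `ρ`-margin
loss: the conditional regret of the cardinality-aware target loss is at most `Δ`, the
conditional regret of the cost-sensitive constrained `ρ`-margin loss. -/
theorem cardinality_aware_consistency_cost_constrained_rho_margin
    (n m : ℕ) (hn : 1 ≤ n) (hm : 2 ≤ m)
    (ρ : ℝ) (hρ : 0 < ρ)
    (p : Fin n → ℝ) (hp : ∀ y, 0 ≤ p y) (hpsum : ∑ y, p y = 1)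
    (c : Fin m → Fin n → ℝ) (hc : ∀ k y, 0 ≤ c k y ∧ c k y ≤ 1)
    (r : Fin m → ℝ) (hr : ∑ k, r k = 0)
    (rhat : Fin m) (hrhat : ∀ k, r k ≤ r rhat)
    (Δ : ℝ)
    (hΔ : Δ = (∑ k, (∑ y, p y * c k y) * min (max 0 (1 + r k / ρ)) 1)
        - sInf {x : ℝ | ∃ r' : Fin m → ℝ, (∑ k, r' k = 0) ∧
            x = ∑ k, (∑ y, p y * c k y) * min (max 0 (1 + r' k / ρ)) 1}) :
    (∑ y, p y * c rhat y) - (⨅ k : Fin m, ∑ y, p y * c k y) ≤ Δ := by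
  have hq : ∀ k, 0 ≤ ∑ y, p y * c k y := fun k =>
    Finset.sum_nonneg fun y _ => mul_nonneg (hp y) (hc k y).1
  have : Nonempty (Fin m) := ⟨rhat⟩
  rw [hΔ]
  refine sub_le_sub (le_sum_mul_clamp_of_isMax hq hρ hr hrhat) (le_ciInf fun k => ?_)
  obtain ⟨r', hr', hval⟩ := exists_sum_eq_zero_sum_mul_clamp_eq (fun k => ∑ y, p y * c k y) hρ k
  refine csInf_le ⟨0, ?_⟩ ⟨r', hr', hval.symm⟩
  rintro _ ⟨s, -, rfl⟩
  exact Finset.sum_nonneg fun j _ =>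
    mul_nonneg (hq j) (le_min (le_max_left _ _) zero_le_one)
end

section
/- Let m ≥ 1, let Y be a finite type of labels, let g : Fin m → Finset Y be a family of set predictors such that k ↦ (g k).card is monotone nondecreasing, let cost : ℕ → ℝ be a nonnegative nondecreasing function, and let λ > 0 satisfy λ · cost((g k).card) ≤ 1 for all k ∈ Fin m. Fix a label y ∈ Y and suppose there exists k with y ∈ g k; let k* be the smallest such k. Then for every k ∈ Fin m: (if y ∉ g k* then 1 else 0) + λ · cost((g k*).card) ≤ (if y ∉ g k then 1 else 0) + λ · cost((g k).card). -/
/-- The paper's lemma on the deterministic scenario: when `λ · cost((g k).card) ≤ 1` for all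
`k` and cardinalities are nondecreasing in `k`, the smallest index `k*` whose predicted set
contains the true label `y` minimizes the cardinality-aware cost. -/
theorem cardinality_aware_bayes_deterministic
    (m : ℕ) (hm : 1 ≤ m) (Y : Type*) [Fintype Y] [DecidableEq Y]
    (g : Fin m → Finset Y) (hg : Monotone fun k => (g k).card)
    (cost : ℕ → ℝ) (hcost0 : ∀ a, 0 ≤ cost a) (hcostmono : Monotone cost)
    (lam : ℝ) (hlam : 0 < lam) (hbound : ∀ k, lam * cost (g k).card ≤ 1)
    (y : Y) (hex : ∃ k, y ∈ g k)
    (kstar : Fin m) (hks : y ∈ g kstar) (hksmin : ∀ k, y ∈ g k → kstar ≤ k) :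
    ∀ k : Fin m,
      (if y ∉ g kstar then (1 : ℝ) else 0) + lam * cost (g kstar).card
        ≤ (if y ∉ g k then (1 : ℝ) else 0) + lam * cost (g k).card := by
  intro k
  rw [if_neg (not_not_intro hks), zero_add]
  by_cases hk : y ∈ g k
  · rw [if_neg (not_not_intro hk), zero_add]
    exact mul_le_mul_of_nonneg_left (hcostmono (hg (hksmin k hk))) hlam.le
  · rw [if_pos hk]
    exact (hbound kstar).trans
      (le_add_of_nonneg_right (mul_nonneg hlam.le (hcost0 _)))
end
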